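/- arXiv:2401.16358 — 3 statements merged into one kernel-verified Lean document; each statement's English description precedes it below -/
import Mathlib

section
/- Assume (0 :_M I) = 0, Ass_R(M / I^n N) is nonempty for all sufficiently large n, and I^{n₀} M ⊆ N for some n₀ (for instance N = M, or N = 𝔞M with I ⊆ √𝔞). Then there exist a ∈ {d_1, …, d_c} and b₁, b₂, b₃ ∈ ℤ such that for all sufficiently large n: indeg(I^n M / I^{n+1} N) = a·n + b₁, v(I^n M / I^{n+1} N) = a·n + b₂, and v(M / I^{n+1} N) = a·n + b₃; i.e. all three functions are eventually linear in n with the same leading coefficient a. Moreover, if Ass_R(I^n M / I^{n+1} N) = Ass_R(M / I^{n+1} N) for all sufficiently large n, then v(I^n M / I^{n+1} N) = v(M / I^{n+1} N) for all sufficiently large n. -/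
namespace ThreeFun

section fin

/-- the set of primes of R which are contracted annihilators -/
def cAss (R : Type*) [CommRing R] (S : Type*) [CommRing S] [Algebra R S]
    (V : Type*) [AddCommGroup V] [Module S V] : Set (Ideal R) :=
  {q | q.IsPrime ∧ ∃ x : V, ∀ r : R, r ∈ q ↔ algebraMap R S r • x = 0}

theorem cAss_finite (R : Type*) [CommRing R] (S : Type*) [CommRing S] [IsNoetherianRing S]
    [Algebra R S] (V : Type*) [AddCommGroup V] [Module S V] (h : Module.Finite S V) :
    (cAss R S V).Finite := by
  induction h using IsNoetherianRing.induction_on_isQuotientEquivQuotientPrime S with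
  | subsingleton N =>
    convert Set.finite_empty
    ext q
    simp only [Set.mem_empty_iff_false, iff_false]
    rintro ⟨hq, x, hx⟩
    exact hq.ne_top ((Ideal.eq_top_iff_one _).2 ((hx 1).2 (Subsingleton.elim _ _)))
  | quotient N p f =>
    refine (Set.finite_singleton (Ideal.comap (algebraMap R S) p.1)).subset ?_
    rintro q ⟨hq, x, hx⟩
    have := p.2
    rw [Set.mem_singleton_iff]
    ext r
    rw [hx, Ideal.mem_comap]
    have hx0 : f x ≠ 0 := by
      intro h
      have h' : x = 0 := by simpa using h
      exact hq.ne_top ((Ideal.eq_top_iff_one _).2 ((hx 1).2 (by simp [h'])))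
    rw [← f.map_eq_zero_iff, map_smul]
    obtain ⟨s, hs⟩ := Ideal.Quotient.mk_surjective (f x)
    rw [← hs] at hx0 ⊢
    have e : algebraMap R S r • (Ideal.Quotient.mk p.1 s) = Ideal.Quotient.mk p.1 (algebraMap R S r * s) := by
      rw [map_mul]; rfl
    rw [e, Ideal.Quotient.eq_zero_iff_mem]
    rw [Ne, Ideal.Quotient.eq_zero_iff_mem] at hx0
    constructor
    · intro h
      exact (this.mem_or_mem h).resolve_right hx0
    · exact fun h => Ideal.mul_mem_right _ _ h
  | exact N₁ N₂ N₃ f g hf _ hfg h₁ h₃ =>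
    refine (h₁.union h₃).subset ?_
    rintro q ⟨hq, x, hx⟩
    by_cases h : ∃ r : R, r ∉ q ∧ g (algebraMap R S r • x) = 0
    · left
      obtain ⟨r, hr, hgr⟩ := h
      obtain ⟨z, hz⟩ := (hfg _).1 hgr
      refine ⟨hq, z, fun s => ?_⟩
      rw [← map_eq_zero_iff f hf, map_smul, hz, smul_smul, ← map_mul, ← hx]
      exact ⟨fun h => Ideal.mul_mem_right _ _ h, fun h => (hq.mem_or_mem h).resolve_right hr⟩
    · right
      push Not at h
      refine ⟨hq, g x, fun s => ⟨fun hs => ?_, fun hs => ?_⟩⟩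
      · rw [← map_smul, (hx s).1 hs, map_zero]
      · by_contra hc
        exact h s hc (by rw [map_smul, hs])

theorem cAss_finite' (R : Type*) [CommRing R] (S : Type*) [CommRing S] [IsNoetherianRing S]
    [Algebra R S] (V : Type*) [AddCommGroup V] [Module S V] (A B : Submodule S V) (h : A.FG) :
    {q : Ideal R | q.IsPrime ∧ ∃ x ∈ A, ∀ r : R, r ∈ q ↔ algebraMap R S r • x ∈ B}.Finite := by
  have : Module.Finite S A := Module.Finite.iff_fg.2 h
  refine (cAss_finite R S (A ⧸ (B.comap A.subtype)) inferInstance).subset ?_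
  rintro q ⟨hq, x, hx, h⟩
  refine ⟨hq, Submodule.Quotient.mk ⟨x, hx⟩, fun r => ?_⟩
  rw [← Submodule.Quotient.mk_smul, Submodule.Quotient.mk_eq_zero, Submodule.mem_comap, h]
  rfl

/-- finitely many primes occur as annihilators of elements of `A n / B n`. -/
theorem filt_finite {R M : Type*} [CommRing R] [IsNoetherianRing R]
    [AddCommGroup M] [Module R M] [Module.Finite R M] {J : Ideal R}
    (A B : J.Filtration M) (hA : A.Stable) :
    {q : Ideal R | q.IsPrime ∧ ∃ n, ∃ x ∈ A.N n, ∀ r, r ∈ q ↔ r • x ∈ B.N n}.Finite := by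
  have hfg : A.submodule.FG := (A.submodule_fg_iff_stable (fun i => IsNoetherian.noetherian _)).2 hA
  refine (cAss_finite' R (reesAlgebra J) (PolynomialModule R M) A.submodule B.submodule hfg).subset ?_
  rintro q ⟨hq, n, x, hx, h⟩
  have key : ∀ (C : J.Filtration M) (z : M), PolynomialModule.single R n z ∈ C.submodule ↔ z ∈ C.N n := by
    intro C z
    rw [Ideal.Filtration.mem_submodule]
    constructor
    · intro h
      simpa using h n
    · intro h i
      rw [PolynomialModule.coeff_single, Finsupp.single_apply]
      split_ifs with hi
      · rwa [← hi]
      · exact zero_mem _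
  refine ⟨hq, PolynomialModule.single R n x, (key A x).2 hx, fun r => ?_⟩
  rw [h, ← key]
  have : algebraMap R (reesAlgebra J) r • PolynomialModule.single R n x
      = PolynomialModule.single R n (r • x) := by
    rw [algebraMap_smul]
    simp [PolynomialModule.single_smul]
  rw [this]

end fin

section colon

theorem pi_mem {R M : Type*} [CommRing R] [AddCommGroup M] [Module R M] (I : Ideal R) (r : ℕ)
    (v : Fin r → M) (hv : ∀ i, v i ∈ (I • ⊤ : Submodule R M)) :
    v ∈ (I • ⊤ : Submodule R (Fin r → M)) := by
  rw [← Finset.univ_sum_single v]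
  refine Submodule.sum_mem _ fun i _ => ?_
  have := Submodule.mem_map_of_mem (f := LinearMap.single R (fun _ : Fin r => M) i) (hv i)
  rw [Submodule.map_smul''] at this
  exact Submodule.smul_mono le_rfl le_top this

theorem colon_pow {R M : Type*} [CommRing R] [IsNoetherianRing R]
    [AddCommGroup M] [Module R M] [Module.Finite R M] (I : Ideal R)
    (h0 : ∀ x : M, (∀ r ∈ I, r • x = 0) → x = 0) :
    ∃ n₁, ∀ n ≥ n₁, ∀ x : M, (∀ r ∈ I, r • x ∈ (I ^ (n + 1) • ⊤ : Submodule R M)) →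
      x ∈ (I ^ n • ⊤ : Submodule R M) := by
  -- Artin-Rees part
  have h1 : ∃ k, ∀ n ≥ k, ∀ x : M, (∀ r ∈ I, r • x ∈ (I ^ n • ⊤ : Submodule R M)) →
      x ∈ (I ^ (n - k) • ⊤ : Submodule R M) := by
    obtain ⟨r, a, ha⟩ := Submodule.fg_iff_exists_fin_generating_family.1 (IsNoetherian.noetherian I)
    let φ : M →ₗ[R] (Fin r → M) := LinearMap.pi fun i => LinearMap.lsmul R M (a i)
    have hφ : Function.Injective φ := by
      rw [injective_iff_map_eq_zero]
      intro x hx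
      apply h0
      have : I ≤ LinearMap.ker (LinearMap.toSpanSingleton R M x) := by
        rw [← ha, Submodule.span_le]
        rintro _ ⟨i, rfl⟩
        exact congrFun hx i
      intro s hs
      simpa using this hs
    obtain ⟨k, hk⟩ := I.exists_pow_inf_eq_pow_smul (LinearMap.range φ)
    refine ⟨k, fun n hn x hx => ?_⟩
    have : φ x ∈ (I ^ n • ⊤ ⊓ LinearMap.range φ : Submodule R (Fin r → M)) := by
      refine ⟨pi_mem _ _ _ fun i => hx _ ?_, LinearMap.mem_range_self _ _⟩
      rw [← ha]
      exact Submodule.subset_span ⟨i, rfl⟩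
    rw [hk n hn] at this
    have h2 : φ x ∈ (I ^ (n - k) • LinearMap.range φ) :=
      Submodule.smul_mono le_rfl inf_le_right this
    rw [LinearMap.range_eq_map, ← Submodule.map_smul''] at h2
    obtain ⟨z, hz, hzx⟩ := h2
    rwa [← hφ hzx]
  have h2 : ∃ n₁, ∀ n > n₁, ∀ x ∈ (I ^ n • ⊤ : Submodule R M),
      (∀ r ∈ I, r • x ∈ (I ^ (n + 2) • ⊤ : Submodule R M)) →
      x ∈ (I ^ (n + 1) • ⊤ : Submodule R M) := by
    have hanti : ∀ m n, m ≤ n → (I ^ n • ⊤ : Submodule R M) ≤ I ^ m • ⊤ := fun m n h =>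
      Submodule.smul_mono (Ideal.pow_le_pow_right h) le_rfl
    have hsm : ∀ n, ∀ r ∈ I, ∀ x ∈ (I ^ n • ⊤ : Submodule R M), r • x ∈ (I ^ (n + 1) • ⊤ : Submodule R M) := by
      intro n r hr x hx
      rw [pow_succ', mul_smul]
      exact Submodule.smul_mem_smul hr hx
    let G : I.Filtration M :=
      { N := fun n =>
          { carrier := {x | x ∈ (I ^ n • ⊤ : Submodule R M) ∧
              ∀ r ∈ I, r • x ∈ (I ^ (n + 2) • ⊤ : Submodule R M)}
            zero_mem' := ⟨zero_mem _, fun r _ => by simp⟩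
            add_mem' := fun ha hb => ⟨add_mem ha.1 hb.1, fun r hr => by
              rw [smul_add]; exact add_mem (ha.2 r hr) (hb.2 r hr)⟩
            smul_mem' := fun s x hx => ⟨Submodule.smul_mem _ _ hx.1, fun r hr => by
              rw [smul_comm]; exact Submodule.smul_mem _ _ (hx.2 r hr)⟩ }
        mono := fun n x hx => ⟨hanti _ _ (by omega) hx.1, fun r hr =>
          hanti _ _ (by omega) (hx.2 r hr)⟩
        smul_le := fun n => by
          rw [Submodule.smul_le]
          intro s hs x hx
          refine ⟨hsm _ _ hs _ hx.1, fun r hr => ?_⟩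
          rw [smul_comm]
          exact hsm (n + 2) s hs _ (hx.2 r hr) }
    have hG : G.Stable := (I.stableFiltration_stable ⊤).of_le (fun n x hx => hx.1)
    obtain ⟨n₁, hn₁⟩ := hG
    refine ⟨n₁, fun n hn x hx hx2 => ?_⟩
    obtain ⟨m, rfl⟩ : ∃ m, n = m + 1 := ⟨n - 1, by omega⟩
    have hxG : x ∈ G.N (m + 1) := ⟨hx, hx2⟩
    rw [← hn₁ m (by omega)] at hxG
    refine Submodule.smul_induction_on hxG (fun r hr z hz => hz.2 r hr) (fun _ _ => add_mem)
  obtain ⟨k, hk⟩ := h1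
  obtain ⟨n₁, hn₁⟩ := h2
  refine ⟨n₁ + k + 1, fun n hn x hx => ?_⟩
  have hstep : ∀ t, n + 1 - k + t ≤ n → x ∈ (I ^ (n + 1 - k + t) • ⊤ : Submodule R M) := by
    intro t
    induction t with
    | zero => exact fun _ => hk (n + 1) (by omega) x hx
    | succ t ih =>
      intro ht
      refine hn₁ (n + 1 - k + t) (by omega) x (ih (by omega)) fun r hr => ?_
      exact Submodule.smul_mono (Ideal.pow_le_pow_right (by omega)) le_rfl (hx r hr)
  by_cases hk0 : k = 0
  · subst hk0
    exact Submodule.smul_mono (Ideal.pow_le_pow_right (by omega)) le_rfl (hk (n+1) (by omega) x hx)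
  · have := hstep (k - 1) (by omega)
    rwa [show n + 1 - k + (k - 1) = n by omega] at this

end colon

end ThreeFun


namespace ThreeFun

section graded

variable {R M : Type*} [CommRing R] [AddCommGroup M] [Module R M]
    (𝒜 : ℤ → AddSubgroup R) (ℳ : ℤ → AddSubgroup M)

/-- homogeneous submodule -/
def Hom [DirectSum.Decomposition ℳ] (P : Submodule R M) : Prop :=
  ∀ x ∈ P, ∀ i : ℤ, (DirectSum.decompose ℳ x i : M) ∈ P

theorem comp_smul [DirectSum.Decomposition ℳ]
    (hsmul : ∀ (i j : ℤ), ∀ r ∈ 𝒜 i, ∀ x ∈ ℳ j, r • x ∈ ℳ (i + j))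
    {i : ℤ} {r : R} (hr : r ∈ 𝒜 i) (x : M) (k : ℤ) :
    (DirectSum.decompose ℳ (r • x) k : M) = r • (DirectSum.decompose ℳ x (k - i) : M) := by
  induction x using DirectSum.Decomposition.inductionOn ℳ with
  | zero => simp
  | @homogeneous j m =>
    by_cases h : j = k - i
    · subst h
      rw [DirectSum.decompose_of_mem_same ℳ m.2]
      have := hsmul _ _ r hr _ m.2
      rw [show i + (k - i) = k by ring] at this
      rw [DirectSum.decompose_of_mem_same ℳ this]
    · rw [DirectSum.decompose_of_mem_ne ℳ m.2 h,
        DirectSum.decompose_of_mem_ne ℳ (hsmul _ _ r hr _ m.2) (by omega), smul_zero]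
  | add a b ha hb =>
    rw [smul_add, DirectSum.decompose_add, DirectSum.decompose_add, DirectSum.add_apply,
      DirectSum.add_apply, AddSubgroup.coe_add, AddSubgroup.coe_add, ha, hb, smul_add]

theorem hom_of_exists [DirectSum.Decomposition ℳ] {E F : Submodule R M} (hE : Hom ℳ E)
    {x : M} (hx : x ∈ E) (hxF : x ∉ F) : ∃ u, ∃ z ∈ ℳ u, z ∈ E ∧ z ∉ F := by
  classical
  by_contra! h
  apply hxF
  rw [← DirectSum.sum_support_decompose ℳ x]
  exact Submodule.sum_mem _ fun i _ => h i _ (SetLike.coe_mem _) (hE x hx i)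

theorem ideal_comp [GradedRing 𝒜] {I : Ideal R} (hI : I.IsHomogeneous 𝒜) {r : R} (hr : r ∈ I)
    (P : AddSubgroup M) (x : M) (h : ∀ i, ∀ s ∈ 𝒜 i, s ∈ I → s • x ∈ P) : r • x ∈ P := by
  classical
  rw [← DirectSum.sum_support_decompose 𝒜 r, Finset.sum_smul]
  exact AddSubgroup.sum_mem _ fun i _ => h i _ (SetLike.coe_mem _) (hI i hr)

theorem hom_top [DirectSum.Decomposition ℳ] : Hom ℳ (⊤ : Submodule R M) := fun _ _ _ => trivial

theorem hom_smul [GradedRing 𝒜] [DirectSum.Decomposition ℳ]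
    (hsmul : ∀ (i j : ℤ), ∀ r ∈ 𝒜 i, ∀ x ∈ ℳ j, r • x ∈ ℳ (i + j))
    {I : Ideal R} (hI : I.IsHomogeneous 𝒜) {P : Submodule R M} (hP : Hom ℳ P) :
    Hom ℳ (I • P) := by
  intro x hx i
  refine Submodule.smul_induction_on hx (fun r hr z hz => ?_) (fun a b ha hb => ?_)
  · let f : M →+ M := (ℳ i).subtype.comp
      ((DFinsupp.evalAddMonoidHom i).comp (DirectSum.decomposeAddEquiv ℳ).toAddMonoidHom)
    have := ideal_comp 𝒜 hI hr ((I • P).toAddSubgroup.comap f) z (fun j s hs hsI => by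
      change (DirectSum.decompose ℳ (s • z) i : M) ∈ I • P
      rw [comp_smul 𝒜 ℳ hsmul hs]
      exact Submodule.smul_mem_smul hsI (hP z hz _))
    exact this
  · rw [DirectSum.decompose_add, DirectSum.add_apply, AddSubgroup.coe_add]
    exact add_mem ha hb

theorem hom_pow_smul [GradedRing 𝒜] [DirectSum.Decomposition ℳ]
    (hsmul : ∀ (i j : ℤ), ∀ r ∈ 𝒜 i, ∀ x ∈ ℳ j, r • x ∈ ℳ (i + j))
    {I : Ideal R} (hI : I.IsHomogeneous 𝒜) {P : Submodule R M} (hP : Hom ℳ P) (n : ℕ) :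
    Hom ℳ (I ^ n • P) := by
  induction n with
  | zero => simpa using hP
  | succ n ih =>
    rw [pow_succ', mul_smul]
    exact hom_smul 𝒜 ℳ hsmul hI ih

/-- the colon ideal `(B : x)` -/
def col (B : Submodule R M) (x : M) : Ideal R := B.comap (LinearMap.toSpanSingleton R M x)

theorem mem_col {B : Submodule R M} {x : M} {r : R} : r ∈ col B x ↔ r • x ∈ B := by
  simp [col]

theorem col_hom [GradedRing 𝒜] [DirectSum.Decomposition ℳ]
    (hsmul : ∀ (i j : ℤ), ∀ r ∈ 𝒜 i, ∀ x ∈ ℳ j, r • x ∈ ℳ (i + j))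
    {B : Submodule R M} (hB : Hom ℳ B) {u : ℤ} {x : M} (hx : x ∈ ℳ u) :
    (col B x).IsHomogeneous 𝒜 := by
  classical
  intro i r hr
  rw [mem_col] at hr ⊢
  have h1 := hB _ hr (i + u)
  have h2 : (DirectSum.decompose ℳ (r • x) (i + u) : M) = (DirectSum.decompose 𝒜 r i : R) • x := by
    conv_lhs => rw [← DirectSum.sum_support_decompose 𝒜 r, Finset.sum_smul]
    rw [DirectSum.decompose_sum, DirectSum.sum_apply, AddSubgroup.val_finsetSum]
    have : ∀ j, (DirectSum.decompose ℳ ((DirectSum.decompose 𝒜 r j : R) • x) (i + u) : M)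
        = if i = j then (DirectSum.decompose 𝒜 r i : R) • x else 0 := by
      intro j
      rw [comp_smul 𝒜 ℳ hsmul (SetLike.coe_mem _)]
      split_ifs with h
      · subst h
        rw [show i + u - i = u by ring, DirectSum.decompose_of_mem_same ℳ hx]
      · rw [DirectSum.decompose_of_mem_ne ℳ hx (by omega), smul_zero]
    simp only [this]
    rw [Finset.sum_ite_eq]
    split_ifs with h
    · rfl
    · rw [DFinsupp.notMem_support_iff] at h
      rw [h]; simp
  rwa [h2] at h1

/-- Homogeneous associated primes exist. -/
theorem exists_hom_prime [IsNoetherianRing R] [GradedRing 𝒜] [DirectSum.Decomposition ℳ]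
    (hsmul : ∀ (i j : ℤ), ∀ r ∈ 𝒜 i, ∀ x ∈ ℳ j, r • x ∈ ℳ (i + j))
    {B : Submodule R M} (hB : Hom ℳ B) {u : ℤ} {x : M} (hx : x ∈ ℳ u) (hxB : x ∉ B) :
    ∃ (r : R) (v : ℤ), r • x ∈ ℳ v ∧ (col B (r • x)).IsPrime := by
  let T : Set (Ideal R) := {q | ∃ (r : R) (v : ℤ), r • x ∈ ℳ v ∧ r • x ∉ B ∧ q = col B (r • x)}
  have hT : T.Nonempty := ⟨_, 1, u, by simpa using hx, by simpa using hxB, rfl⟩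
  obtain ⟨q, ⟨r, v, h1, h2, rfl⟩, hmax⟩ := set_has_maximal_iff_noetherian.2 ‹IsNoetherianRing R› T hT
  refine ⟨r, v, h1, ?_⟩
  refine Ideal.IsHomogeneous.isPrime_of_homogeneous_mem_or_mem (col_hom 𝒜 ℳ hsmul hB h1) ?_ ?_
  · intro h
    apply h2
    have : (1 : R) ∈ col B (r • x) := h ▸ Submodule.mem_top
    simpa [mem_col] using this
  · rintro a b ⟨i, ha⟩ ⟨j, hb⟩ hab
    by_contra! hc
    have hbz : b • r • x ∉ B := fun h => hc.2 (mem_col.2 h)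
    have hm : col B ((b * r) • x) ∈ T := by
      refine ⟨b * r, j + v, ?_, ?_, rfl⟩
      · rw [mul_smul]; exact hsmul _ _ _ hb _ h1
      · rwa [mul_smul]
    refine hmax _ hm (lt_of_le_of_ne ?_ ?_)
    · intro s hs
      rw [mem_col] at hs ⊢
      rw [mul_smul, smul_comm]
      exact B.smul_mem _ hs
    · intro he
      apply hc.1
      rw [he, mem_col, mul_smul, smul_smul]
      exact mem_col.1 hab

theorem min_degree [Module.Finite R M] [GradedRing 𝒜] [DirectSum.Decomposition ℳ]
    (hsmul : ∀ (i j : ℤ), ∀ r ∈ 𝒜 i, ∀ x ∈ ℳ j, r • x ∈ ℳ (i + j))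
    (hA : ∀ i : ℤ, i < 0 → 𝒜 i = ⊥) :
    ∃ m : ℤ, ∀ u, ∀ x ∈ ℳ u, x ≠ 0 → m ≤ u := by
  classical
  obtain ⟨S, hS⟩ := (Module.Finite.fg_top : (⊤ : Submodule R M).FG)
  obtain ⟨m, hm⟩ := (S.biUnion fun x => (DirectSum.decompose ℳ x).support).bddBelow
  have key : ∀ x : M, ∀ i < m, (DirectSum.decompose ℳ x i : M) = 0 := by
    intro x
    have hx : x ∈ Submodule.span R (S : Set M) := hS ▸ Submodule.mem_top
    induction hx using Submodule.span_induction with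
    | mem x hx =>
      intro i hi
      by_contra hc
      have : i ∈ (S.biUnion fun x => (DirectSum.decompose ℳ x).support) := by
        rw [Finset.mem_biUnion]
        refine ⟨x, hx, ?_⟩
        rw [DFinsupp.mem_support_iff]
        intro h
        exact hc (by rw [h]; rfl)
      have := hm this
      omega
    | zero => simp
    | add a b _ _ ha hb =>
      intro i hi
      rw [DirectSum.decompose_add, DirectSum.add_apply, AddSubgroup.coe_add, ha i hi, hb i hi, add_zero]
    | smul r x _ ih =>
      intro i hi
      rw [← DirectSum.sum_support_decompose 𝒜 r, Finset.sum_smul, DirectSum.decompose_sum,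
        DirectSum.sum_apply, AddSubgroup.val_finsetSum]
      refine Finset.sum_eq_zero fun j _ => ?_
      rw [comp_smul 𝒜 ℳ hsmul (SetLike.coe_mem _)]
      by_cases hj : j < 0
      · have h0 : ∀ s ∈ 𝒜 j, s = 0 := by
          intro s hs
          rwa [hA j hj, AddSubgroup.mem_bot] at hs
        rw [h0 _ (SetLike.coe_mem _), zero_smul]
      · rw [ih _ (by omega), smul_zero]
  refine ⟨m, fun u x hx h0 => ?_⟩
  by_contra! hc
  apply h0
  have := key x u hc
  rwa [DirectSum.decompose_of_mem_same ℳ hx] at this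

end graded
end ThreeFun

namespace ThreeFun
section filt

variable {R M : Type*} [CommRing R] [AddCommGroup M] [Module R M]
    (𝒜 : ℤ → AddSubgroup R) (ℳ : ℤ → AddSubgroup M) {J : Ideal R}

/-- degrees of homogeneous elements of `E n` not in `F n` -/
def DD (E F : J.Filtration M) (n : ℕ) : Set ℤ := {u | ∃ x ∈ ℳ u, x ∈ E.N n ∧ x ∉ F.N n}

/-- nilpotency of y on `E/F` -/
def Nil (y : R) (E F : J.Filtration M) : Prop :=
  ∃ k n₀ : ℕ, ∀ n ≥ n₀, ∀ x ∈ E.N n, y ^ k • x ∈ F.N (n + k)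

theorem smul_step {F : J.Filtration M} {n : ℕ} {r : R} (hr : r ∈ J) {x : M} (hx : x ∈ F.N n) :
    r • x ∈ F.N (n + 1) := F.smul_le n (Submodule.smul_mem_smul hr hx)

theorem pow_step {F : J.Filtration M} {n : ℕ} {r : R} (hr : r ∈ J) {x : M} (hx : x ∈ F.N n) (k : ℕ) :
    r ^ k • x ∈ F.N (n + k) := by
  rw [add_comm]
  exact F.pow_smul_le k n (Submodule.smul_mem_smul (Ideal.pow_mem_pow hr k) hx)

theorem pow_step' {F : J.Filtration M} {n : ℕ} {y : R} (hr : y ∈ J) {x : M} {k l : ℕ} (hkl : k ≤ l)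
    (hx : y ^ k • x ∈ F.N (n + k)) : y ^ l • x ∈ F.N (n + l) := by
  obtain ⟨m, rfl⟩ := Nat.exists_eq_add_of_le hkl
  have := pow_step hr hx m
  rwa [smul_smul, ← pow_add, add_comm m k, add_assoc] at this

/-- saturation of F in E with respect to y -/
def sat (E F : J.Filtration M) (y : R) (hy : y ∈ J) : J.Filtration M where
  N n :=
    { carrier := {x | x ∈ E.N n ∧ ∃ k : ℕ, y ^ k • x ∈ F.N (n + k)}
      zero_mem' := ⟨zero_mem _, 0, by simp⟩
      add_mem' := by
        rintro a b ⟨ha, k, hk⟩ ⟨hb, l, hl⟩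
        refine ⟨add_mem ha hb, max k l, ?_⟩
        rw [smul_add]
        exact add_mem (pow_step' hy (le_max_left _ _) hk) (pow_step' hy (le_max_right _ _) hl)
      smul_mem' := by
        rintro r x ⟨hx, k, hk⟩
        refine ⟨Submodule.smul_mem _ _ hx, k, ?_⟩
        rw [smul_comm]
        exact Submodule.smul_mem _ _ hk }
  mono := by
    rintro n x ⟨hx, k, hk⟩
    exact ⟨E.mono n hx, k, F.antitone (by omega) hk⟩
  smul_le := by
    intro n
    rw [Submodule.smul_le]
    rintro r hr x ⟨hx, k, hk⟩
    refine ⟨smul_step hr hx, k, ?_⟩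
    rw [smul_comm, show n + 1 + k = n + k + 1 by ring]
    exact smul_step hr hk

theorem mem_sat {E F : J.Filtration M} {y : R} {hy : y ∈ J} {n : ℕ} {x : M} :
    x ∈ (sat E F y hy).N n ↔ x ∈ E.N n ∧ ∃ k : ℕ, y ^ k • x ∈ F.N (n + k) := Iff.rfl

theorem pow_mem_deg [GradedRing 𝒜] {y : R} {e : ℤ} (hy : y ∈ 𝒜 e) (k : ℕ) : y ^ k ∈ 𝒜 (k * e) := by
  have := SetLike.pow_mem_graded k hy
  rwa [nsmul_eq_mul] at this

theorem sat_hom [GradedRing 𝒜] [DirectSum.Decomposition ℳ]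
    (hsmul : ∀ (i j : ℤ), ∀ r ∈ 𝒜 i, ∀ x ∈ ℳ j, r • x ∈ ℳ (i + j))
    {E F : J.Filtration M} (hE : ∀ n, Hom ℳ (E.N n)) (hF : ∀ n, Hom ℳ (F.N n))
    {y : R} (hyJ : y ∈ J) {e : ℤ} (hy : y ∈ 𝒜 e) (n : ℕ) : Hom ℳ ((sat E F y hyJ).N n) := by
  rintro x ⟨hx, k, hk⟩ i
  refine ⟨hE n x hx i, k, ?_⟩
  have := hF _ _ hk (i + k * e)
  rwa [comp_smul 𝒜 ℳ hsmul (pow_mem_deg 𝒜 hy k), add_sub_cancel_right] at this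

theorem sat_nil [IsNoetherianRing R] [Module.Finite R M] {E F : J.Filtration M} {y : R} (hyJ : y ∈ J)
    (hst : (sat E F y hyJ).Stable) : Nil y (sat E F y hyJ) F := by
  obtain ⟨n₁, hn₁⟩ := hst
  let f : ℕ →o Submodule R M :=
    ⟨fun k => (F.N (n₁ + k)).comap (LinearMap.lsmul R M (y ^ k)), fun k l hkl x hx =>
      pow_step' hyJ hkl hx⟩
  obtain ⟨k, hk⟩ := monotone_stabilizes_iff_noetherian.2 (inferInstance : IsNoetherian R M) f
  refine ⟨k, n₁, fun n hn => ?_⟩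
  obtain ⟨t, rfl⟩ := Nat.exists_eq_add_of_le hn
  clear hn
  induction t with
  | zero =>
    rintro x ⟨hx, l, hl⟩
    have h1 : x ∈ f (max k l) := f.monotone (le_max_right k l) hl
    rw [← hk _ (le_max_left _ _)] at h1
    exact h1
  | succ t ih =>
    intro x hx
    rw [← add_assoc, ← hn₁ (n₁ + t) (by omega)] at hx
    refine Submodule.smul_induction_on hx (fun r hr z hz => ?_) (fun a b ha hb => ?_)
    · rw [smul_comm, show n₁ + (t + 1) + k = n₁ + t + k + 1 by ring]
      exact smul_step hr (ih z hz)
    · rw [smul_add]; exact add_mem ha hb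

theorem span_smul_mem {c : ℕ} (y : Fin c → R) (E : Submodule R M) {x : M}
    (hJ : J = Ideal.span (Set.range y)) (hx : x ∈ J • E) : ∃ e : Fin c → M, (∀ j, e j ∈ E) ∧ x = ∑ j, y j • e j := by
  rw [hJ] at hx
  refine Submodule.smul_induction_on hx (fun r hr z hz => ?_) ?_
  · obtain ⟨f, rfl⟩ := (Ideal.mem_span_range_iff_exists_fun).1 hr
    exact ⟨fun j => f j • z, fun j => E.smul_mem _ hz, by
      rw [Finset.sum_smul]; exact Finset.sum_congr rfl fun j _ => by rw [smul_smul, mul_comm]⟩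
  · rintro a b ⟨e, he, rfl⟩ ⟨f, hf, rfl⟩
    exact ⟨e + f, fun j => add_mem (he j) (hf j), by simp [Finset.sum_add_distrib, smul_add]⟩

theorem mono_expand [GradedRing 𝒜] [DirectSum.Decomposition ℳ]
    (hsmul : ∀ (i j : ℤ), ∀ r ∈ 𝒜 i, ∀ x ∈ ℳ j, r • x ∈ ℳ (i + j))
    {c : ℕ} (y : Fin c → R) (d : Fin c → ℤ) (hy : ∀ j, y j ∈ 𝒜 (d j))
    (hJ : J = Ideal.span (Set.range y)) {E : J.Filtration M} (hE : ∀ n, Hom ℳ (E.N n))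
    (n₁ : ℕ) (hst : ∀ n ≥ n₁, J • E.N n = E.N (n + 1)) (Q : Submodule R M) (t : ℕ) :
    ∀ (u : ℤ) (x : M), x ∈ ℳ u → x ∈ E.N (n₁ + t) → ∀ w : R, w • x ∉ Q →
      ∃ α : Fin c → ℕ, ∑ j, α j = t ∧ ∃ g ∈ ℳ (u - ∑ j, α j * d j), g ∈ E.N n₁ ∧
        w • (∏ j, y j ^ α j) • g ∉ Q := by
  induction t with
  | zero =>
    intro u x hx hxE w hw
    exact ⟨0, by simp, x, by simpa using hx, hxE, by simpa using hw⟩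
  | succ t ih =>
    intro u x hx hxE w hw
    rw [← add_assoc, ← hst _ (by omega)] at hxE
    obtain ⟨e, he, hxe⟩ := span_smul_mem y _ hJ hxE
    have hxe' : x = ∑ j, y j • (DirectSum.decompose ℳ (e j) (u - d j) : M) := by
      have := congrArg (fun z => (DirectSum.decompose ℳ z u : M)) hxe
      simp only [DirectSum.decompose_of_mem_same ℳ hx, DirectSum.decompose_sum, DirectSum.sum_apply,
        AddSubgroup.val_finsetSum, comp_smul 𝒜 ℳ hsmul (hy _)] at this
      exact this
    obtain ⟨j, hj⟩ : ∃ j, (w * y j) • (DirectSum.decompose ℳ (e j) (u - d j) : M) ∉ Q := by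
      by_contra! h
      apply hw
      rw [hxe', Finset.smul_sum]
      exact Submodule.sum_mem _ fun j _ => by rw [smul_smul]; exact h j
    obtain ⟨α, hα, g, hg, hgE, hgQ⟩ := ih (u - d j) _ (SetLike.coe_mem _) (hE _ _ (he j) _) _ hj
    refine ⟨α + Pi.single j 1, ?_, g, ?_, hgE, ?_⟩
    · simp [Finset.sum_add_distrib, hα]
    · convert hg using 2
      have : ∀ i, (((α + Pi.single j 1 : Fin c → ℕ) i : ℕ) : ℤ) * d i
          = α i * d i + if i = j then d j else 0 := by
        intro i
        by_cases h : i = j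
        · subst h; simp; ring
        · simp [h]
      simp only [this, Finset.sum_add_distrib]
      simp
      ring
    · have : ∏ i, y i ^ ((α + Pi.single j 1 : Fin c → ℕ) i) = y j * ∏ i, y i ^ α i := by
        simp only [Pi.add_apply, pow_add, Finset.prod_mul_distrib]
        rw [mul_comm, Finset.prod_eq_single j]
        · simp
        · intro i _ h; simp [h]
        · simp
      rwa [this, mul_smul, smul_smul]

theorem mono_bound [Module.Finite R M] [GradedRing 𝒜] [DirectSum.Decomposition ℳ]
    (hsmul : ∀ (i j : ℤ), ∀ r ∈ 𝒜 i, ∀ x ∈ ℳ j, r • x ∈ ℳ (i + j))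
    (hA : ∀ i : ℤ, i < 0 → 𝒜 i = ⊥)
    {c : ℕ} (y : Fin c → R) (d : Fin c → ℤ) (hy : ∀ j, y j ∈ 𝒜 (d j))
    (hJ : J = Ideal.span (Set.range y)) {E F : J.Filtration M} (hE : ∀ n, Hom ℳ (E.N n))
    (hst : E.Stable) (s : Set (Fin c)) (hs : ∀ j, j ∉ s → Nil (y j) E F) :
    ∃ (n₁ K : ℕ) (m : ℤ), ∀ t u, u ∈ DD ℳ E F (n₁ + t) →
      ∃ α : Fin c → ℕ, ∑ j, α j = t ∧ (∀ j, j ∉ s → α j < K) ∧ m + ∑ j, α j * d j ≤ u := by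
  have hyJ : ∀ j, y j ∈ J := fun j => hJ ▸ Ideal.subset_span ⟨j, rfl⟩
  have hs' : ∀ j, ∃ k n₀ : ℕ, j ∉ s → ∀ n ≥ n₀, ∀ x ∈ E.N n, y j ^ k • x ∈ F.N (n + k) := by
    intro j
    by_cases h : j ∈ s
    · exact ⟨0, 0, fun h' => absurd h h'⟩
    · obtain ⟨k, n₀, h'⟩ := hs j h
      exact ⟨k, n₀, fun _ => h'⟩
  choose k n₀ hk using hs'
  obtain ⟨n₂, hn₂⟩ := hst
  obtain ⟨m, hm⟩ := min_degree 𝒜 ℳ hsmul hA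
  refine ⟨n₂ + ∑ j, n₀ j, ∑ j, k j, m, ?_⟩
  rintro t u ⟨x, hx, hxE, hxF⟩
  obtain ⟨α, hα, g, hg, hgE, hgF⟩ := mono_expand 𝒜 ℳ hsmul y d hy hJ hE (n₂ + ∑ j, n₀ j)
    (fun n hn => hn₂ n (by omega)) (F.N (n₂ + ∑ j, n₀ j + t)) t u x hx hxE 1 (by simpa using hxF)
  rw [one_smul] at hgF
  refine ⟨α, hα, fun j hj => ?_, ?_⟩
  · by_contra! hc
    apply hgF
    have hkj : k j ≤ α j := (Finset.single_le_sum (fun _ _ => Nat.zero_le _) (Finset.mem_univ j)).trans hc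
    have hnj : n₀ j ≤ n₂ + ∑ j, n₀ j :=
      (Finset.single_le_sum (f := n₀) (fun _ _ => Nat.zero_le _) (Finset.mem_univ j)).trans (by omega)
    have h1 := hk j hj _ hnj g hgE
    let β : Fin c → ℕ := α - Pi.single j (k j)
    have hβ : α = β + Pi.single j (k j) := by
      funext i
      by_cases h : i = j
      · subst h; simp [β]; omega
      · simp [β, h]
    have h2 : ∏ i, y i ^ α i = (∏ i, y i ^ β i) * y j ^ k j := by
      rw [hβ]
      simp only [Pi.add_apply, pow_add, Finset.prod_mul_distrib]
      congr 1
      rw [Finset.prod_eq_single j]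
      · simp
      · intro i _ h; simp [h]
      · simp
    have h3 : ∏ i, y i ^ β i ∈ J ^ (∑ i, β i) := by
      rw [← Finset.prod_pow_eq_pow_sum]
      exact Ideal.prod_mem_prod fun i _ => Ideal.pow_mem_pow (hyJ i) _
    have h4 : ∑ i, β i + k j = t := by
      rw [← hα, hβ]
      simp [Finset.sum_add_distrib]
    rw [h2, mul_smul]
    have h5 := F.pow_smul_le _ _ (Submodule.smul_mem_smul h3 h1)
    rwa [show ∑ i, β i + (n₂ + ∑ j, n₀ j + k j) = n₂ + ∑ j, n₀ j + t by omega] at h5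
  · have := hm _ g hg (fun h => hgF (by simp [h]))
    linarith

end filt
end ThreeFun

namespace ThreeFun
section evlin

/-- eventually empty or eventually having a least element that is linear in n -/
def EvLin {c : ℕ} (d : Fin c → ℤ) (s : Set (Fin c)) (D : ℕ → Set ℤ) : Prop :=
  (∃ n₀ : ℕ, ∀ n ≥ n₀, D n = ∅) ∨
    ∃ j ∈ s, ∃ (b : ℤ) (n₀ : ℕ), ∀ n ≥ n₀, IsLeast (D n) (d j * (n : ℤ) + b)

theorem EvLin.mono {c : ℕ} {d : Fin c → ℤ} {s t : Set (Fin c)} (h : s ⊆ t) {D : ℕ → Set ℤ}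
    (hD : EvLin d s D) : EvLin d t D := by
  rcases hD with hD | ⟨j, hj, hD⟩
  · exact Or.inl hD
  · exact Or.inr ⟨j, h hj, hD⟩

theorem least_union {A B : Set ℤ} {a b : ℤ} (ha : IsLeast A a) (hb : IsLeast B b) (h : a ≤ b) :
    IsLeast (A ∪ B) a := by
  refine ⟨Or.inl ha.1, ?_⟩
  rintro x (hx | hx)
  · exact ha.2 hx
  · exact h.trans (hb.2 hx)

/-- Of two linear functions one is eventually at most the other. -/
theorem lin_cmp (a b a' b' : ℤ) : ∃ n₀ : ℕ, (∀ n : ℕ, n ≥ n₀ → a * n + b ≤ a' * n + b') ∨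
    (∀ n : ℕ, n ≥ n₀ → a' * n + b' ≤ a * n + b) := by
  have aux : ∀ a b a' b' : ℤ, a < a' → ∃ n₀ : ℕ, ∀ n : ℕ, n ≥ n₀ → a * n + b ≤ a' * n + b' := by
    intro a b a' b' h
    refine ⟨(b - b').toNat, fun n hn => ?_⟩
    have h1 : b - b' ≤ n := by omega
    nlinarith [Int.natCast_nonneg n]
  rcases lt_trichotomy a a' with h | h | h
  · obtain ⟨n₀, h'⟩ := aux a b a' b' h
    exact ⟨n₀, Or.inl h'⟩
  · subst h
    rcases le_total b b' with h | h
    · exact ⟨0, Or.inl fun n _ => by linarith⟩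
    · exact ⟨0, Or.inr fun n _ => by linarith⟩
  · obtain ⟨n₀, h'⟩ := aux a' b' a b h
    exact ⟨n₀, Or.inr h'⟩

theorem EvLin.union {c : ℕ} {d : Fin c → ℤ} {s : Set (Fin c)} {D D' : ℕ → Set ℤ}
    (h : EvLin d s D) (h' : EvLin d s D') : EvLin d s (fun n => D n ∪ D' n) := by
  rcases h with ⟨n₀, h⟩ | ⟨j, hj, b, n₀, h⟩
  · rcases h' with ⟨n₁, h'⟩ | ⟨j', hj', b', n₁, h'⟩
    · exact Or.inl ⟨max n₀ n₁, fun n hn => by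
        simp [h n (le_trans (le_max_left _ _) hn), h' n (le_trans (le_max_right _ _) hn)]⟩
    · exact Or.inr ⟨j', hj', b', max n₀ n₁, fun n hn => by
        simpa [h n (le_trans (le_max_left _ _) hn)] using h' n (le_trans (le_max_right _ _) hn)⟩
  · rcases h' with ⟨n₁, h'⟩ | ⟨j', hj', b', n₁, h'⟩
    · exact Or.inr ⟨j, hj, b, max n₀ n₁, fun n hn => by
        simpa [h' n (le_trans (le_max_right _ _) hn)] using h n (le_trans (le_max_left _ _) hn)⟩
    · obtain ⟨n₂, h2 | h2⟩ := lin_cmp (d j) b (d j') b'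
      · exact Or.inr ⟨j, hj, b, max n₀ (max n₁ n₂), fun n hn =>
          least_union (h n (by omega)) (h' n (by omega)) (h2 n (by omega))⟩
      · exact Or.inr ⟨j', hj', b', max n₀ (max n₁ n₂), fun n hn => by
          show IsLeast (D n ∪ D' n) _
          rw [Set.union_comm]
          exact least_union (h' n (by omega)) (h n (by omega)) (h2 n (by omega))⟩

theorem EvLin.biUnion {c : ℕ} {d : Fin c → ℤ} {s : Set (Fin c)} {ι : Type*} (P : Set ι) (hP : P.Finite)
    (D : ι → ℕ → Set ℤ) (h : ∀ p ∈ P, EvLin d s (D p)) : EvLin d s (fun n => ⋃ p ∈ P, D p n) := by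
  induction P, hP using Set.Finite.induction_on with
  | empty => exact Or.inl ⟨0, fun n _ => by simp⟩
  | @insert a S _ _ ih =>
    simp only [Set.biUnion_insert]
    exact (h a (Set.mem_insert _ _)).union (ih fun p hp => h p (Set.mem_insert_of_mem _ hp))

theorem lin_of_shift (D : ℕ → Set ℤ) (a : ℤ) (hshift : ∀ n, ∀ u ∈ D n, u + a ∈ D (n + 1))
    (C : ℤ) (n₃ : ℕ) (hlow : ∀ n ≥ n₃, ∀ u ∈ D n, a * n - C ≤ u) (n₀ : ℕ) (hne : (D n₀).Nonempty) :
    ∃ (b : ℤ) (n₁ : ℕ), ∀ n ≥ n₁, IsLeast (D n) (a * (n : ℤ) + b) := by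
  have hsh : ∀ n u t, u ∈ D n → u + a * (t : ℕ) ∈ D (n + t) := by
    intro n u t hu
    induction t with
    | zero => simpa using hu
    | succ t ih =>
      have := hshift _ _ ih
      rw [show u + a * ((t + 1 : ℕ) : ℤ) = u + a * t + a by push_cast; ring]
      exact this
  let T : Set ℤ := {b | ∃ n ≥ n₃, a * (n : ℤ) + b ∈ D n}
  have hT : T.Nonempty := by
    obtain ⟨u, hu⟩ := hne
    refine ⟨u - a * n₀, n₀ + n₃, by omega, ?_⟩
    convert hsh _ _ n₃ hu using 1
    push_cast; ring
  obtain ⟨b, ⟨n₁, hn₁, hb⟩, hmin⟩ := Int.exists_least_of_bdd (P := fun b => b ∈ T) ⟨-C, by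
    rintro b ⟨n, hn, hb⟩
    have := hlow n hn _ hb
    linarith⟩ hT
  refine ⟨b, n₁, fun n hn => ⟨?_, fun u hu => ?_⟩⟩
  · obtain ⟨t, rfl⟩ := Nat.exists_eq_add_of_le hn
    convert hsh _ _ t hb using 1
    push_cast; ring
  · have := hmin (u - a * n) ⟨n, by omega, by rwa [add_sub_cancel]⟩
    linarith

variable {R M : Type*} [CommRing R] [AddCommGroup M] [Module R M]
    (𝒜 : ℤ → AddSubgroup R) (ℳ : ℤ → AddSubgroup M) {J : Ideal R}

/-- Lower bound -/
theorem lower_bound [Module.Finite R M] [GradedRing 𝒜] [DirectSum.Decomposition ℳ]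
    (hsmul : ∀ (i j : ℤ), ∀ r ∈ 𝒜 i, ∀ x ∈ ℳ j, r • x ∈ ℳ (i + j))
    (hA : ∀ i : ℤ, i < 0 → 𝒜 i = ⊥)
    {c : ℕ} (y : Fin c → R) (d : Fin c → ℤ) (hy : ∀ j, y j ∈ 𝒜 (d j))
    (hJ : J = Ideal.span (Set.range y)) {E F : J.Filtration M} (hE : ∀ n, Hom ℳ (E.N n))
    (hst : E.Stable) (a : ℤ) (hs : ∀ j, d j < a → Nil (y j) E F) :
    ∃ (C : ℤ) (n₃ : ℕ), ∀ n ≥ n₃, ∀ u ∈ DD ℳ E F n, a * n - C ≤ u := by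
  obtain ⟨n₁, K, m, h⟩ := mono_bound 𝒜 ℳ hsmul hA y d hy hJ hE hst {j | a ≤ d j}
    (fun j hj => hs j (by simpa using hj))
  refine ⟨a * n₁ - m + ∑ j, K * |d j - a|, n₁, fun n hn u hu => ?_⟩
  obtain ⟨t, rfl⟩ := Nat.exists_eq_add_of_le hn
  obtain ⟨α, h1, h2, h3⟩ := h t u hu
  have h4 : ∑ j, (α j : ℤ) * d j ≥ ∑ j, ((α j : ℤ) * a - K * |d j - a|) := by
    refine Finset.sum_le_sum fun j _ => ?_
    by_cases hj : a ≤ d j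
    · have : 0 ≤ (K : ℤ) * |d j - a| := by positivity
      have : (α j : ℤ) * a ≤ α j * d j := mul_le_mul_of_nonneg_left hj (by positivity)
      linarith
    · have hlt := h2 j hj
      push Not at hj
      rw [abs_of_neg (by linarith)]
      have : (α j : ℤ) ≤ K := by exact_mod_cast hlt.le
      nlinarith
  rw [Finset.sum_sub_distrib, ← Finset.sum_mul] at h4
  have h5 : ∑ j, (α j : ℤ) = t := by exact_mod_cast h1
  rw [h5] at h4
  push_cast
  linarith

theorem evLin_main [IsNoetherianRing R] [Module.Finite R M] [GradedRing 𝒜] [DirectSum.Decomposition ℳ]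
    (hsmul : ∀ (i j : ℤ), ∀ r ∈ 𝒜 i, ∀ x ∈ ℳ j, r • x ∈ ℳ (i + j))
    (hA : ∀ i : ℤ, i < 0 → 𝒜 i = ⊥)
    {c : ℕ} (y : Fin c → R) (d : Fin c → ℤ) (hd : Monotone d) (hy : ∀ j, y j ∈ 𝒜 (d j))
    (hJ : J = Ideal.span (Set.range y)) (s : Finset (Fin c)) :
    ∀ (E F : J.Filtration M), (∀ n, Hom ℳ (E.N n)) → (∀ n, Hom ℳ (F.N n)) → E.Stable →
      (∀ n, F.N n ≤ E.N n) → (∀ j, j ∉ s → Nil (y j) E F) → EvLin d s (DD ℳ E F) := by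
  have hyJ : ∀ j, y j ∈ J := fun j => hJ ▸ Ideal.subset_span ⟨j, rfl⟩
  induction s using Finset.induction_on_min with
  | empty =>
    intro E F hE hF hst hFE hnil
    left
    obtain ⟨n₁, K, m, h⟩ := mono_bound 𝒜 ℳ hsmul hA y d hy hJ hE hst ∅
      (fun j hj => hnil j (by simp))
    refine ⟨n₁ + (∑ _j : Fin c, K) + 1, fun n hn => ?_⟩
    rw [Set.eq_empty_iff_forall_notMem]
    intro u hu
    obtain ⟨t, rfl⟩ := Nat.exists_eq_add_of_le (show n₁ ≤ n by omega)
    obtain ⟨α, h1, h2, h3⟩ := h t u hu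
    have : ∑ j, α j ≤ ∑ _j : Fin c, K := Finset.sum_le_sum fun j _ => (h2 j (by simp)).le
    omega
  | insert a s has ih =>
    intro E F hE hF hst hFE hnil
    let K := sat E F (y a) (hyJ a)
    have hKE : ∀ n, K.N n ≤ E.N n := fun n x hx => hx.1
    have hFK : ∀ n, F.N n ≤ K.N n := fun n x hx => ⟨hFE n hx, 0, by simpa using hx⟩
    have hKhom : ∀ n, Hom ℳ (K.N n) := sat_hom 𝒜 ℳ hsmul hE hF (hyJ a) (hy a)
    have hKst : K.Stable := hst.of_le hKE
    have h1 : EvLin d s (DD ℳ K F) := by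
      refine ih K F hKhom hF hKst hFK fun j hj => ?_
      by_cases hja : j = a
      · subst hja
        exact sat_nil (hyJ j) hKst
      · obtain ⟨k, n₀, h⟩ := hnil j (by simp [hja, hj])
        exact ⟨k, n₀, fun n hn x hx => h n hn x (hKE n hx)⟩
    have hu : DD ℳ E F = fun n => DD ℳ E K n ∪ DD ℳ K F n := by
      funext n
      ext u
      constructor
      · rintro ⟨x, hx, hxE, hxF⟩
        by_cases hxK : x ∈ K.N n
        · exact Or.inr ⟨x, hx, hxK, hxF⟩
        · exact Or.inl ⟨x, hx, hxE, hxK⟩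
      · rintro (⟨x, hx, hxE, hxF⟩ | ⟨x, hx, hxE, hxF⟩)
        · exact ⟨x, hx, hxE, fun h => hxF (hFK n h)⟩
        · exact ⟨x, hx, hKE n hxE, hxF⟩
    rw [hu]
    refine EvLin.union ?_ (h1.mono (by simp))
    by_cases hem : ∀ n, DD ℳ E K n = ∅
    · exact Or.inl ⟨0, fun n _ => hem n⟩
    push Not at hem
    obtain ⟨n₀, hn₀⟩ := hem
    right
    refine ⟨a, by simp, ?_⟩
    obtain ⟨C, n₃, hC⟩ := lower_bound 𝒜 ℳ hsmul hA y d hy hJ (F := K) hE hst (d a) (fun j hj => by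
      obtain ⟨k, n₀, h⟩ := hnil j (by
        rw [Finset.mem_insert]
        rintro (rfl | h)
        · exact lt_irrefl _ hj
        · exact absurd (hd (has j h).le) (not_le.2 hj))
      exact ⟨k, n₀, fun n hn x hx => hFK _ (h n hn x hx)⟩)
    refine lin_of_shift (DD ℳ E K) (d a) ?_ C n₃ hC n₀ hn₀
    rintro n u ⟨x, hx, hxE, hxK⟩
    refine ⟨y a • x, ?_, smul_step (hyJ a) hxE, ?_⟩
    · rw [add_comm]; exact hsmul _ _ _ (hy a) _ hx
    · rintro ⟨_, k, hk⟩
      refine hxK ⟨hxE, k + 1, ?_⟩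
      rw [pow_succ, mul_smul, show n + (k + 1) = n + 1 + k by ring]
      exact hk

end evlin
end ThreeFun

namespace ThreeFun
section vnum

variable {R M : Type*} [CommRing R] [AddCommGroup M] [Module R M]
    (𝒜 : ℤ → AddSubgroup R) (ℳ : ℤ → AddSubgroup M) {J : Ideal R}

/-- elements of A killed by p modulo B -/
def colF (A B : J.Filtration M) (p : Ideal R) : J.Filtration M where
  N n :=
    { carrier := {x | x ∈ A.N n ∧ ∀ r ∈ p, r • x ∈ B.N n}
      zero_mem' := ⟨zero_mem _, fun r _ => by simp⟩
      add_mem' := fun ha hb => ⟨add_mem ha.1 hb.1, fun r hr => by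
        rw [smul_add]; exact add_mem (ha.2 r hr) (hb.2 r hr)⟩
      smul_mem' := fun s x hx => ⟨Submodule.smul_mem _ _ hx.1, fun r hr => by
        rw [smul_comm]; exact Submodule.smul_mem _ _ (hx.2 r hr)⟩ }
  mono n x hx := ⟨A.mono n hx.1, fun r hr => B.mono n (hx.2 r hr)⟩
  smul_le n := by
    rw [Submodule.smul_le]
    intro s hs x hx
    refine ⟨smul_step hs hx.1, fun r hr => ?_⟩
    rw [smul_comm]
    exact smul_step hs (hx.2 r hr)

/-- elements of `colF` killed modulo B by a homogeneous element outside p -/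
def locF [GradedRing 𝒜] (A B : J.Filtration M) (p : PrimeSpectrum R) : J.Filtration M where
  N n :=
    { carrier := {x | x ∈ (colF A B p.1).N n ∧ ∃ i, ∃ s ∈ 𝒜 i, s ∉ p.1 ∧ s • x ∈ B.N n}
      zero_mem' := ⟨zero_mem _, 0, 1, SetLike.one_mem_graded 𝒜,
        fun h => p.2.ne_top ((Ideal.eq_top_iff_one _).2 h), by simp⟩
      add_mem' := by
        rintro a b ⟨ha, i, s, hs, hsp, hsa⟩ ⟨hb, j, t, ht, htp, htb⟩
        refine ⟨add_mem ha hb, i + j, s * t, SetLike.mul_mem_graded hs ht,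
          fun h => (p.2.mem_or_mem h).elim hsp htp, ?_⟩
        rw [smul_add]
        refine add_mem ?_ ?_
        · rw [mul_comm, mul_smul]; exact Submodule.smul_mem _ _ hsa
        · rw [mul_smul]; exact Submodule.smul_mem _ _ htb
      smul_mem' := by
        rintro r x ⟨hx, i, s, hs, hsp, hsx⟩
        refine ⟨Submodule.smul_mem _ _ hx, i, s, hs, hsp, ?_⟩
        rw [smul_comm]
        exact Submodule.smul_mem _ _ hsx }
  mono := by
    rintro n x ⟨hx, i, s, hs, hsp, hsx⟩
    exact ⟨(colF A B p.1).mono n hx, i, s, hs, hsp, B.mono n hsx⟩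
  smul_le n := by
    rw [Submodule.smul_le]
    rintro r hr x ⟨hx, i, s, hs, hsp, hsx⟩
    refine ⟨smul_step hr hx, i, s, hs, hsp, ?_⟩
    rw [smul_comm]
    exact smul_step hr hsx

theorem colF_hom [GradedRing 𝒜] [DirectSum.Decomposition ℳ]
    (hsmul : ∀ (i j : ℤ), ∀ r ∈ 𝒜 i, ∀ x ∈ ℳ j, r • x ∈ ℳ (i + j))
    {A B : J.Filtration M} (hA : ∀ n, Hom ℳ (A.N n)) (hB : ∀ n, Hom ℳ (B.N n))
    {p : Ideal R} (hp : p.IsHomogeneous 𝒜) (n : ℕ) : Hom ℳ ((colF A B p).N n) := by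
  rintro x ⟨hx, h⟩ i
  refine ⟨hA n x hx i, fun r hr => ?_⟩
  refine ideal_comp 𝒜 hp hr (B.N n).toAddSubgroup _ fun j s hs hsp => ?_
  have := hB n _ (h s hsp) (i + j)
  rwa [comp_smul 𝒜 ℳ hsmul hs, add_sub_cancel_right] at this

theorem locF_hom [GradedRing 𝒜] [DirectSum.Decomposition ℳ]
    (hsmul : ∀ (i j : ℤ), ∀ r ∈ 𝒜 i, ∀ x ∈ ℳ j, r • x ∈ ℳ (i + j))
    {A B : J.Filtration M} (hA : ∀ n, Hom ℳ (A.N n)) (hB : ∀ n, Hom ℳ (B.N n))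
    {p : PrimeSpectrum R} (hp : p.1.IsHomogeneous 𝒜) (n : ℕ) : Hom ℳ ((locF 𝒜 A B p).N n) := by
  rintro x ⟨hx, j, s, hs, hsp, hsx⟩ i
  refine ⟨colF_hom 𝒜 ℳ hsmul hA hB hp n x hx i, j, s, hs, hsp, ?_⟩
  have := hB n _ hsx (i + j)
  rwa [comp_smul 𝒜 ℳ hsmul hs, add_sub_cancel_right] at this

/-- degrees of homogeneous elements with prime annihilator -/
def Dv (A B : J.Filtration M) (n : ℕ) : Set ℤ :=
  {u | ∃ x ∈ ℳ u, x ∈ A.N n ∧ ∃ q : Ideal R, q.IsPrime ∧ ∀ r, r ∈ q ↔ r • x ∈ B.N n}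

theorem Dv_evLin [IsNoetherianRing R] [Module.Finite R M] [GradedRing 𝒜] [DirectSum.Decomposition ℳ]
    (hsmul : ∀ (i j : ℤ), ∀ r ∈ 𝒜 i, ∀ x ∈ ℳ j, r • x ∈ ℳ (i + j))
    (hA : ∀ i : ℤ, i < 0 → 𝒜 i = ⊥)
    {c : ℕ} (y : Fin c → R) (d : Fin c → ℤ) (hd : Monotone d) (hy : ∀ j, y j ∈ 𝒜 (d j))
    (hJ : J = Ideal.span (Set.range y)) (A B : J.Filtration M)
    (hAh : ∀ n, Hom ℳ (A.N n)) (hBh : ∀ n, Hom ℳ (B.N n)) (hst : A.Stable) :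
    EvLin d Set.univ (Dv ℳ A B) := by
  let P : Set (PrimeSpectrum R) := {q | q.1.IsHomogeneous 𝒜 ∧
    ∃ n, ∃ x ∈ A.N n, ∀ r, r ∈ q.1 ↔ r • x ∈ B.N n}
  have hP : P.Finite := by
    refine ((filt_finite A B hst).preimage (f := PrimeSpectrum.asIdeal)
      (fun _ _ _ _ h => PrimeSpectrum.ext h)).subset ?_
    rintro q ⟨_, n, x, hx, h⟩
    exact ⟨q.2, n, x, hx, h⟩
  have hD : Dv ℳ A B = fun n => ⋃ q ∈ P, DD ℳ (colF A B q.1) (locF 𝒜 A B q) n := by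
    funext n
    ext u
    simp only [Set.mem_iUnion]
    constructor
    · rintro ⟨x, hx, hxA, q, hq, h⟩
      have hqe : q = col (B.N n) x := by ext r; rw [h, mem_col]
      refine ⟨⟨q, hq⟩, ⟨?_, n, x, hxA, h⟩, x, hx, ⟨hxA, fun r hr => (h r).1 hr⟩, ?_⟩
      · have hh : q.IsHomogeneous 𝒜 := by rw [hqe]; exact col_hom 𝒜 ℳ hsmul (hBh n) hx
        exact hh
      · rintro ⟨_, i, s, _, hsp, hsx⟩
        exact hsp ((h s).2 hsx)
    · rintro ⟨q, _, x, hx, hxc, hxl⟩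
      refine ⟨x, hx, hxc.1, q.1, q.2, fun r => ⟨fun hr => hxc.2 r hr, fun hr => ?_⟩⟩
      classical
      have hhom := col_hom 𝒜 ℳ hsmul (hBh n) hx
      rw [← DirectSum.sum_support_decompose 𝒜 r]
      refine Submodule.sum_mem _ fun i _ => ?_
      by_contra hc
      exact hxl ⟨hxc, i, _, SetLike.coe_mem _, hc, mem_col.1 (hhom i (mem_col.2 hr))⟩
  rw [hD]
  refine EvLin.biUnion P hP _ fun p hp => ?_
  have := evLin_main 𝒜 ℳ hsmul hA y d hd hy hJ Finset.univ (colF A B p.1) (locF 𝒜 A B p)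
    (colF_hom 𝒜 ℳ hsmul hAh hBh hp.1) (locF_hom 𝒜 ℳ hsmul hAh hBh hp.1)
    (hst.of_le fun n x hx => hx.1) (fun n x hx => hx.1) (fun j hj => absurd (Finset.mem_univ j) hj)
  exact this.mono (Set.subset_univ _)

theorem Dv_upper [IsNoetherianRing R] [Module.Finite R M] [GradedRing 𝒜] [DirectSum.Decomposition ℳ]
    (hsmul : ∀ (i j : ℤ), ∀ r ∈ 𝒜 i, ∀ x ∈ ℳ j, r • x ∈ ℳ (i + j))
    {y : R} (hyJ : y ∈ J) {e : ℤ} (hy : y ∈ 𝒜 e) (A B : J.Filtration M)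
    (hAh : ∀ n, Hom ℳ (A.N n)) (hBh : ∀ n, Hom ℳ (B.N n)) (hst : A.Stable)
    (hnil : ¬ Nil y A B) : ∃ (C : ℤ) (n₀ : ℕ), ∀ n ≥ n₀, e * n + C ∈ Dv ℳ A B n := by
  let K := sat A B y hyJ
  have hKst : K.Stable := hst.of_le fun n x hx => hx.1
  obtain ⟨n, x, hxA, hxK⟩ : ∃ n, ∃ x ∈ A.N n, x ∉ K.N n := by
    by_contra! h
    apply hnil
    obtain ⟨k, n₀, hk⟩ := sat_nil hyJ hKst
    exact ⟨k, n₀, fun n hn x hx => hk n hn x (h n x hx)⟩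
  obtain ⟨u, z, hz, hzA, hzK⟩ := hom_of_exists ℳ (hAh n) hxA hxK
  obtain ⟨r, v, hrz, hprime⟩ := exists_hom_prime 𝒜 ℳ hsmul
    (sat_hom 𝒜 ℳ hsmul hAh hBh hyJ hy n) hz hzK
  set w := r • z with hw
  have hwA : w ∈ A.N n := Submodule.smul_mem _ _ hzA
  let f : ℕ →o Submodule R R :=
    ⟨fun k => (B.N (n + k)).comap ((LinearMap.lsmul R M (y ^ k)).comp (LinearMap.toSpanSingleton R M w)),
      fun k l hkl s hs => pow_step' hyJ hkl hs⟩
  have hf : ∀ k s, s ∈ f k ↔ y ^ k • s • w ∈ B.N (n + k) := fun k s => Iff.rfl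
  obtain ⟨k, hk⟩ := monotone_stabilizes_iff_noetherian.2 (inferInstance : IsNoetherian R R) f
  refine ⟨v - e * n, n + k, fun m hm => ?_⟩
  obtain ⟨t, rfl⟩ := Nat.exists_eq_add_of_le (show n ≤ m by omega)
  refine ⟨y ^ t • w, ?_, pow_step hyJ hwA t, _, hprime, fun s => ?_⟩
  · have := hsmul _ _ _ (pow_mem_deg 𝒜 hy t) _ hrz
    convert this using 2
    push_cast; ring
  · rw [mem_col, smul_comm s (y ^ t) w, ← hf]
    constructor
    · rintro ⟨_, l, hl⟩
      have h1 : s ∈ f (max k l) := f.monotone (le_max_right k l) ((hf l s).2 hl)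
      rw [← hk _ (le_max_left _ _)] at h1
      exact f.monotone (show k ≤ t by omega) h1
    · intro h
      exact ⟨Submodule.smul_mem _ _ hwA, t, (hf t s).1 h⟩

theorem slope_le {a b a' b' : ℤ} (n₀ : ℕ) (h : ∀ n : ℕ, n ≥ n₀ → a * n + b ≤ a' * n + b') : a ≤ a' := by
  by_contra! hc
  have h1 := h (n₀ + (b' - b).toNat + 1) (by omega)
  have h2 : b' - b ≤ (b' - b).toNat := Int.self_le_toNat _
  push_cast at h1
  nlinarith [Int.natCast_nonneg n₀, Int.natCast_nonneg (b' - b).toNat]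

end vnum
end ThreeFun

/-- Same setup as Statement 9.  Assume `(0 :_M I) = 0`, that
`Ass_R(M / I^n N)` is nonempty for all sufficiently large `n`, and that `I^{n₀} M ⊆ N` for
some `n₀`.  Then there are `a ∈ {d 1, …, d c}` and `b₁, b₂, b₃ ∈ ℤ` such that, for all
sufficiently large `n`, `indeg(I^n M / I^(n+1) N) = a * n + b₁`,
`v(I^n M / I^(n+1) N) = a * n + b₂` and `v(M / I^(n+1) N) = a * n + b₃`; i.e. all three
functions are eventually linear in `n` with the same leading coefficient `a`.  Moreover,
if `Ass_R(I^n M / I^(n+1) N) = Ass_R(M / I^(n+1) N)` for all sufficiently large `n`, then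
`v(I^n M / I^(n+1) N) = v(M / I^(n+1) N)` for all sufficiently large `n`. -/
theorem three_functions_eventually_linear_same_leading_coefficient
    {R M : Type*} [CommRing R] [IsNoetherianRing R]
    [AddCommGroup M] [Module R M] [Module.Finite R M]
    (𝒜 : ℤ → AddSubgroup R) (ℳ : ℤ → AddSubgroup M)
    [GradedRing 𝒜] [DirectSum.Decomposition ℳ]
    (hsmul : ∀ (i j : ℤ), ∀ r ∈ 𝒜 i, ∀ x ∈ ℳ j, r • x ∈ ℳ (i + j))
    (hA : ∀ i : ℤ, i < 0 → 𝒜 i = ⊥)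
    (I : Ideal R) (hI : Ideal.IsHomogeneous 𝒜 I)
    (N : Submodule R M) (hN : ∀ x ∈ N, ∀ i : ℤ, (DirectSum.decompose ℳ x i : M) ∈ N)
    (c : ℕ) (y : Fin c → R) (d : Fin c → ℤ) (hdmono : Monotone d)
    (hy : ∀ j, y j ∈ 𝒜 (d j))
    (J : Ideal R) (hJgen : J = Ideal.span (Set.range y)) (hJI : J ≤ I)
    (m0 : ℕ) (hred : J * I ^ m0 = I ^ (m0 + 1))
    (h0 : ∀ x : M, (∀ r ∈ I, r • x = 0) → x = 0)
    (hassne : ∃ n₀ : ℕ, ∀ n ≥ n₀, ∃ q : Ideal R, q.IsPrime ∧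
      ∃ x : M, ∀ r : R, r ∈ q ↔ r • x ∈ (I ^ n • N : Submodule R M))
    (hpow : ∃ n₀ : ℕ, (I ^ n₀ • ⊤ : Submodule R M) ≤ N) :
    (∃ j : Fin c, ∃ b₁ b₂ b₃ : ℤ, ∃ n₁ : ℕ, ∀ n ≥ n₁,
      sInf {u : ℤ | ∃ x ∈ ℳ u, x ∈ (I ^ n • ⊤ : Submodule R M) ∧
          x ∉ (I ^ (n + 1) • N : Submodule R M)} = d j * (n : ℤ) + b₁ ∧
      sInf {u : ℤ | ∃ x ∈ ℳ u, x ∈ (I ^ n • ⊤ : Submodule R M) ∧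
          ∃ q : Ideal R, q.IsPrime ∧
            ∀ r : R, r ∈ q ↔ r • x ∈ (I ^ (n + 1) • N : Submodule R M)}
        = d j * (n : ℤ) + b₂ ∧
      sInf {u : ℤ | ∃ x ∈ ℳ u, ∃ q : Ideal R, q.IsPrime ∧
          ∀ r : R, r ∈ q ↔ r • x ∈ (I ^ (n + 1) • N : Submodule R M)}
        = d j * (n : ℤ) + b₃) ∧
    ((∃ n₀ : ℕ, ∀ n ≥ n₀,
        {q : Ideal R | q.IsPrime ∧ ∃ x ∈ (I ^ n • ⊤ : Submodule R M),
            ∀ r : R, r ∈ q ↔ r • x ∈ (I ^ (n + 1) • N : Submodule R M)}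
          = {q : Ideal R | q.IsPrime ∧ ∃ x : M,
              ∀ r : R, r ∈ q ↔ r • x ∈ (I ^ (n + 1) • N : Submodule R M)}) →
      ∃ n₂ : ℕ, ∀ n ≥ n₂,
        sInf {u : ℤ | ∃ x ∈ ℳ u, x ∈ (I ^ n • ⊤ : Submodule R M) ∧
            ∃ q : Ideal R, q.IsPrime ∧
              ∀ r : R, r ∈ q ↔ r • x ∈ (I ^ (n + 1) • N : Submodule R M)}
          = sInf {u : ℤ | ∃ x ∈ ℳ u, ∃ q : Ideal R, q.IsPrime ∧
              ∀ r : R, r ∈ q ↔ r • x ∈ (I ^ (n + 1) • N : Submodule R M)}) := by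
  classical
  obtain ⟨nA, hassne⟩ := hassne
  obtain ⟨nN, hpow⟩ := hpow
  obtain ⟨nC, hcol⟩ := ThreeFun.colon_pow I h0
  have hyJ : ∀ j, y j ∈ J := fun j => hJgen ▸ Ideal.subset_span ⟨j, rfl⟩
  -- elements with prime annihilator lie in `I ^ n • ⊤`
  have hmem : ∀ n ≥ nC, ∀ (x : M) (q : Ideal R), q.IsPrime →
      (∀ r : R, r ∈ q ↔ r • x ∈ (I ^ (n + 1) • N : Submodule R M)) →
      x ∈ (I ^ n • ⊤ : Submodule R M) := by
    intro n hn x q hq h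
    have h1 : I ^ (n + 1 + nN) ≤ q := by
      intro r hr
      rw [h]
      have : r • x ∈ (I ^ (n + 1 + nN) • ⊤ : Submodule R M) :=
        Submodule.smul_mem_smul hr Submodule.mem_top
      rw [pow_add, mul_smul] at this
      exact Submodule.smul_mono le_rfl hpow this
    have h2 : I ≤ q := hq.le_of_pow_le h1
    exact hcol n hn x fun r hr => Submodule.smul_mono le_rfl le_top ((h r).1 (h2 hr))
  let A : J.Filtration M :=
    { N := fun n => I ^ n • ⊤
      mono := fun n => Submodule.smul_mono (Ideal.pow_le_pow_right (by omega)) le_rfl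
      smul_le := fun n => by
        rw [pow_succ', mul_smul]
        exact Submodule.smul_mono hJI le_rfl }
  let B : J.Filtration M :=
    { N := fun n => I ^ (n + 1) • N
      mono := fun n => Submodule.smul_mono (Ideal.pow_le_pow_right (by omega)) le_rfl
      smul_le := fun n => by
        rw [pow_succ' I (n + 1), mul_smul]
        exact Submodule.smul_mono hJI le_rfl }
  have hAst : A.Stable := by
    refine ⟨m0, fun n hn => ?_⟩
    obtain ⟨t, rfl⟩ := Nat.exists_eq_add_of_le hn
    change J • (I ^ (m0 + t) • ⊤ : Submodule R M) = I ^ (m0 + t + 1) • ⊤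
    rw [← mul_smul, pow_add, ← mul_assoc, hred, ← pow_add, show m0 + 1 + t = m0 + t + 1 by ring]
  have hAh : ∀ n, ThreeFun.Hom ℳ (A.N n) := fun n =>
    ThreeFun.hom_pow_smul 𝒜 ℳ hsmul hI (ThreeFun.hom_top ℳ) n
  have hBh : ∀ n, ThreeFun.Hom ℳ (B.N n) := fun n =>
    ThreeFun.hom_pow_smul 𝒜 ℳ hsmul hI hN (n + 1)
  have hBA : ∀ n, B.N n ≤ A.N n := fun n =>
    Submodule.smul_mono (Ideal.pow_le_pow_right (by omega)) le_top
  have hsub : ∀ n, ThreeFun.Dv ℳ A B n ⊆ ThreeFun.DD ℳ A B n := by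
    rintro n u ⟨x, hx, hxA, q, hq, h⟩
    refine ⟨x, hx, hxA, fun hxB => hq.ne_top ((Ideal.eq_top_iff_one _).2 ((h 1).2 ?_))⟩
    rwa [one_smul]
  have hne : ∀ n ≥ max nA nC, (ThreeFun.Dv ℳ A B n).Nonempty := by
    intro n hn
    obtain ⟨q, hq, x, h⟩ := hassne (n + 1) (by omega)
    have hxA : x ∈ A.N n := hmem n (by omega) x q hq h
    have hxB : x ∉ B.N n := fun hxB => hq.ne_top ((Ideal.eq_top_iff_one _).2 ((h 1).2 (by
      rw [one_smul]; exact hxB)))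
    obtain ⟨u, z, hz, hzA, hzB⟩ := ThreeFun.hom_of_exists ℳ (hAh n) hxA hxB
    obtain ⟨r, v, hrz, hp⟩ := ThreeFun.exists_hom_prime 𝒜 ℳ hsmul (hBh n) hz hzB
    exact ⟨v, r • z, hrz, Submodule.smul_mem _ _ hzA, _, hp, fun s => ThreeFun.mem_col⟩
  have hDeq : ∀ n ≥ nC, {u : ℤ | ∃ x ∈ ℳ u, ∃ q : Ideal R, q.IsPrime ∧
      ∀ r : R, r ∈ q ↔ r • x ∈ (I ^ (n + 1) • N : Submodule R M)} = ThreeFun.Dv ℳ A B n := by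
    intro n hn
    ext u
    constructor
    · rintro ⟨x, hx, q, hq, h⟩
      exact ⟨x, hx, hmem n hn x q hq h, q, hq, h⟩
    · rintro ⟨x, hx, _, q, hq, h⟩
      exact ⟨x, hx, q, hq, h⟩
  refine ⟨?_, fun _ => ⟨nC, fun n hn => by rw [hDeq n hn]; rfl⟩⟩
  have hD1 := ThreeFun.evLin_main 𝒜 ℳ hsmul hA y d hdmono hy hJgen Finset.univ A B hAh hBh hAst hBA
    (fun j hj => absurd (Finset.mem_univ j) hj)
  have hD2 := ThreeFun.Dv_evLin 𝒜 ℳ hsmul hA y d hdmono hy hJgen A B hAh hBh hAst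
  rcases hD1 with ⟨n₀, h⟩ | ⟨j, -, b₁, n₁, h1⟩
  · obtain ⟨u, hu⟩ := hne (max (max nA nC) n₀) (le_max_left _ _)
    have := hsub _ hu
    rw [h _ (le_max_right _ _)] at this
    exact absurd this (Set.notMem_empty _)
  rcases hD2 with ⟨n₀, h⟩ | ⟨j', -, b₂, n₂, h2⟩
  · obtain ⟨u, hu⟩ := hne (max (max nA nC) n₀) (le_max_left _ _)
    rw [h _ (le_max_right _ _)] at hu
    exact absurd hu (Set.notMem_empty _)
  have hle : d j ≤ d j' := by
    refine ThreeFun.slope_le (b := b₁) (b' := b₂) (max n₁ n₂) fun n hn => ?_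
    exact (h1 n (by omega)).2 (hsub n (h2 n (by omega)).1)
  have hge : d j' ≤ d j := by
    obtain ⟨C, n₃, h3⟩ := ThreeFun.lower_bound 𝒜 ℳ hsmul hA y d hy hJgen (F := B) hAh hAst (d j')
      (fun k hk => by
        by_contra hnil
        obtain ⟨C, n₀, hC⟩ := ThreeFun.Dv_upper 𝒜 ℳ hsmul (hyJ k) (hy k) A B hAh hBh hAst hnil
        refine absurd (ThreeFun.slope_le (a := d j') (b := b₂) (a' := d k) (b' := C) (max n₀ n₂)
          fun n hn => ?_) (not_le.2 hk)
        exact (h2 n (by omega)).2 (hC n (by omega)))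
    refine ThreeFun.slope_le (b := -C) (b' := b₁) (max n₁ n₃) fun n hn => ?_
    have := h3 n (by omega) _ (h1 n (by omega)).1
    linarith
  have heq : d j' = d j := le_antisymm hge hle
  refine ⟨j, b₁, b₂, b₂, max nC (max n₁ n₂), fun n hn => ⟨?_, ?_, ?_⟩⟩
  · exact (h1 n (by omega)).csInf_eq
  · rw [← heq]
    exact (h2 n (by omega)).csInf_eq
  · rw [hDeq n (by omega), ← heq]
    exact (h2 n (by omega)).csInf_eq
end

section
/- Assume (0 :_M I) = 0, Ass_R(M / I^n N) is nonempty for all sufficiently large n, I^{n₀} M ⊆ N for some n₀, and moreover (0 :_M y_1) = 0 and d_1 ≥ 1. Then the common leading coefficient of the eventually linear functions indeg(I^n M / I^{n+1} N), v(I^n M / I^{n+1} N) and v(M / I^{n+1} N) equals d_1; in particular there exists b ∈ ℤ with v(M / I^{n+1} N) = d_1·n + b for all sufficiently large n. -/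
set_option linter.unusedSectionVars false

section graded
open DirectSum
variable {R M : Type*} [CommRing R] [AddCommGroup M] [Module R M]
    (𝒜 : ℤ → AddSubgroup R) (ℳ : ℤ → AddSubgroup M)
    [GradedRing 𝒜] [DirectSum.Decomposition ℳ]

theorem aux_comp_smul (hsmul : ∀ (i j : ℤ), ∀ r ∈ 𝒜 i, ∀ x ∈ ℳ j, r • x ∈ ℳ (i + j))
    {i : ℤ} {r : R} (hr : r ∈ 𝒜 i) (x : M) (j : ℤ) :
    (decompose ℳ (r • x) j : M) = r • (decompose ℳ x (j - i) : M) := by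
  induction x using DirectSum.Decomposition.inductionOn ℳ with
  | zero => simp
  | @homogeneous k m =>
    have h := hsmul i k r hr m m.2
    by_cases hk : i + k = j
    · subst hk
      rw [decompose_of_mem_same ℳ h, show i + k - i = k by ring, decompose_of_mem_same ℳ m.2]
    · rw [decompose_of_mem_ne ℳ h hk, decompose_of_mem_ne ℳ m.2 (by intro h; apply hk; omega),
        smul_zero]
  | add a b ha hb => simp only [smul_add, decompose_add, DirectSum.add_apply, AddSubgroup.coe_add, ha, hb]

theorem aux_comp_smul' (hsmul : ∀ (i j : ℤ), ∀ r ∈ 𝒜 i, ∀ x ∈ ℳ j, r • x ∈ ℳ (i + j))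
    {u : ℤ} {x : M} (hx : x ∈ ℳ u) (r : R) (j : ℤ) :
    (decompose ℳ (r • x) j : M) = (decompose 𝒜 r (j - u) : R) • x := by
  induction r using DirectSum.Decomposition.inductionOn 𝒜 with
  | zero => simp
  | @homogeneous k m =>
    have h := hsmul k u m m.2 x hx
    by_cases hk : k + u = j
    · subst hk
      rw [decompose_of_mem_same ℳ h, show k + u - u = k by ring, decompose_of_mem_same 𝒜 m.2]
    · rw [decompose_of_mem_ne ℳ h hk, decompose_of_mem_ne 𝒜 m.2 (by intro h; apply hk; omega),
        zero_smul]
  | add a b ha hb => simp only [add_smul, decompose_add, DirectSum.add_apply, AddSubgroup.coe_add, ha, hb]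

theorem aux_colon_hom (hsmul : ∀ (i j : ℤ), ∀ r ∈ 𝒜 i, ∀ x ∈ ℳ j, r • x ∈ ℳ (i + j))
    (L : Submodule R M) (hL : ∀ x ∈ L, ∀ i : ℤ, (decompose ℳ x i : M) ∈ L)
    {u : ℤ} {x : M} (hx : x ∈ ℳ u) (q : Ideal R) (hq : ∀ r, r ∈ q ↔ r • x ∈ L) :
    q.IsHomogeneous 𝒜 := by
  intro i r hr
  rw [hq] at hr ⊢
  have := hL _ hr (i + u)
  rwa [aux_comp_smul' 𝒜 ℳ hsmul hx, add_sub_cancel_right] at this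

theorem aux_smul_hom (hsmul : ∀ (i j : ℤ), ∀ r ∈ 𝒜 i, ∀ x ∈ ℳ j, r • x ∈ ℳ (i + j))
    (I : Ideal R) (hI : Ideal.IsHomogeneous 𝒜 I)
    (L : Submodule R M) (hL : ∀ x ∈ L, ∀ i : ℤ, (decompose ℳ x i : M) ∈ L) :
    ∀ x ∈ I • L, ∀ i : ℤ, (decompose ℳ x i : M) ∈ I • L := by
  intro x hx i
  induction hx using Submodule.smul_induction_on' with
  | smul r hr m hm =>
    classical
    rw [← sum_support_decompose 𝒜 r, Finset.sum_smul, decompose_sum]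
    rw [DirectSum.sum_apply, AddSubgroup.val_finsetSum]
    refine Submodule.sum_mem _ fun k _ => ?_
    rw [aux_comp_smul 𝒜 ℳ hsmul (decompose 𝒜 r k).2]
    exact Submodule.smul_mem_smul (hI k hr) (hL m hm _)
  | add a _ b _ ha hb =>
    simp only [decompose_add, DirectSum.add_apply, AddSubgroup.coe_add]
    exact add_mem ha hb

theorem aux_pow_smul_hom (hsmul : ∀ (i j : ℤ), ∀ r ∈ 𝒜 i, ∀ x ∈ ℳ j, r • x ∈ ℳ (i + j))
    (I : Ideal R) (hI : Ideal.IsHomogeneous 𝒜 I)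
    (L : Submodule R M) (hL : ∀ x ∈ L, ∀ i : ℤ, (decompose ℳ x i : M) ∈ L) (n : ℕ) :
    ∀ x ∈ I ^ n • L, ∀ i : ℤ, (decompose ℳ x i : M) ∈ I ^ n • L := by
  induction n with
  | zero => simpa using hL
  | succ n ih =>
    rw [pow_succ', mul_smul]
    exact aux_smul_hom 𝒜 ℳ hsmul I hI _ ih

/-- degrees are bounded below -/
theorem aux_bdd [Module.Finite R M]
    (hsmul : ∀ (i j : ℤ), ∀ r ∈ 𝒜 i, ∀ x ∈ ℳ j, r • x ∈ ℳ (i + j))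
    (hA : ∀ i : ℤ, i < 0 → 𝒜 i = ⊥) : ∃ B : ℤ, ∀ u, ∀ x ∈ ℳ u, x ≠ 0 → B ≤ u := by
  classical
  obtain ⟨S, hS⟩ := (Module.Finite.fg_top : (⊤ : Submodule R M).FG)
  have h1 : ∃ B : ℤ, ∀ s ∈ S, ∀ i < B, (decompose ℳ s i : M) = 0 := by
    obtain ⟨B, hB⟩ := ((S.biUnion fun s => (decompose ℳ s).support).bddBelow)
    refine ⟨B, fun s hs i hi => ?_⟩
    by_contra h
    have : i ∈ S.biUnion fun s => (decompose ℳ s).support := by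
      rw [Finset.mem_biUnion]
      refine ⟨s, hs, ?_⟩
      rw [DFinsupp.mem_support_iff]
      intro h'
      exact h (by rw [h']; rfl)
    have := hB this
    omega
  obtain ⟨B, hB⟩ := h1
  have h2 : ∀ x : M, ∀ i < B, (decompose ℳ x i : M) = 0 := by
    intro x
    have hx : x ∈ Submodule.span R (S : Set M) := by rw [hS]; trivial
    induction hx using Submodule.span_induction with
    | mem x h => exact hB x h
    | zero => simp
    | add a b _ _ ha hb =>
      intro i hi
      simp only [decompose_add, DirectSum.add_apply, AddSubgroup.coe_add, ha i hi, hb i hi, add_zero]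
    | smul r x _ hx =>
      intro i hi
      rw [← sum_support_decompose 𝒜 r, Finset.sum_smul, decompose_sum]
      rw [DirectSum.sum_apply, AddSubgroup.val_finsetSum]
      refine Finset.sum_eq_zero fun k _ => ?_
      rw [aux_comp_smul 𝒜 ℳ hsmul (decompose 𝒜 r k).2]
      by_cases hk : k < 0
      · have h3 : ∀ t ∈ 𝒜 k, t = 0 := by
          intro t ht
          rwa [hA k hk, AddSubgroup.mem_bot] at ht
        rw [h3 _ (decompose 𝒜 r k).2, zero_smul]
      · rw [hx _ (by omega), smul_zero]
  refine ⟨B, fun u x hx hx0 => ?_⟩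
  by_contra h
  apply hx0
  rw [← decompose_of_mem_same ℳ hx]
  exact h2 x u (by omega)

theorem aux_split (hsmul : ∀ (i j : ℤ), ∀ r ∈ 𝒜 i, ∀ x ∈ ℳ j, r • x ∈ ℳ (i + j))
    {c : ℕ} (y : Fin c → R) (d : Fin c → ℤ) (hy : ∀ j, y j ∈ 𝒜 (d j))
    (K : Submodule R M) (hK : ∀ x ∈ K, ∀ i : ℤ, (decompose ℳ x i : M) ∈ K)
    {u : ℤ} {x : M} (hxu : x ∈ ℳ u) (hx : x ∈ Ideal.span (Set.range y) • K) :
    ∃ w : Fin c → M, (∀ j, w j ∈ K) ∧ (∀ j, w j ∈ ℳ (u - d j)) ∧ x = ∑ j, y j • w j := by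
  have h1 : ∃ w : Fin c → M, (∀ j, w j ∈ K) ∧ x = ∑ j, y j • w j := by
    clear hxu
    induction hx using Submodule.smul_induction_on' with
    | smul r hr m hm =>
      obtain ⟨a, rfl⟩ := Ideal.mem_span_range_iff_exists_fun.1 hr
      refine ⟨fun j => a j • m, fun j => K.smul_mem _ hm, ?_⟩
      rw [Finset.sum_smul]
      exact Finset.sum_congr rfl fun j _ => by rw [mul_comm, mul_smul]
    | add a _ b _ ha hb =>
      obtain ⟨w, hw, rfl⟩ := ha
      obtain ⟨w', hw', rfl⟩ := hb
      refine ⟨w + w', fun j => K.add_mem (hw j) (hw' j), ?_⟩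
      simp [smul_add, Finset.sum_add_distrib]
  obtain ⟨w, hw, h⟩ := h1
  refine ⟨fun j => (decompose ℳ (w j) (u - d j) : M), fun j => hK _ (hw j) _,
    fun j => (decompose ℳ (w j) (u - d j)).2, ?_⟩
  rw [← decompose_of_mem_same ℳ hxu, h, decompose_sum, DirectSum.sum_apply,
    AddSubgroup.val_finsetSum]
  exact Finset.sum_congr rfl fun j _ => aux_comp_smul 𝒜 ℳ hsmul (hy j) _ _

theorem aux_prime [IsNoetherianRing R] (a : Ideal R) (ha : a.IsHomogeneous 𝒜) (hne : a ≠ ⊤) :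
    ∃ s : ℤ, ∃ r ∈ 𝒜 s, ∃ q : Ideal R, q.IsPrime ∧ ∀ t, t ∈ q ↔ t * r ∈ a := by
  let T : Set (Ideal R) := {b | ∃ s : ℤ, ∃ r ∈ 𝒜 s, r ∉ a ∧ ∀ t, t ∈ b ↔ t * r ∈ a}
  have hT : T.Nonempty := ⟨a, 0, 1, SetLike.GradedOne.one_mem,
    fun h => hne ((Ideal.eq_top_iff_one _).2 h), by simp⟩
  obtain ⟨q, ⟨s, r, hr, hra, hq⟩, hmax⟩ := set_has_maximal_iff_noetherian.mpr ‹_› T hT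
  refine ⟨s, r, hr, q, ?_, hq⟩
  have hqh : q.IsHomogeneous 𝒜 := aux_colon_hom 𝒜 𝒜
    (fun i j r hr x hx => SetLike.GradedMul.mul_mem hr hx) a (fun x hx i => ha i hx) hr q hq
  refine Ideal.IsHomogeneous.isPrime_of_homogeneous_mem_or_mem hqh ?_ ?_
  · intro h
    have : (1 : R) ∈ q := h ▸ trivial
    rw [hq, one_mul] at this
    exact hra this
  · rintro f g - ⟨k, hg⟩ hfg
    by_contra! hcon
    let b : Ideal R := Submodule.comap (LinearMap.mulRight R (g * r)) a
    have hb : ∀ t, t ∈ b ↔ t * (g * r) ∈ a := fun t => Iff.rfl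
    refine hmax b ⟨k + s, g * r, SetLike.GradedMul.mul_mem hg hr, ?_, hb⟩ ?_
    · rw [← hq]; exact hcon.2
    · refine lt_of_le_of_ne (fun t ht => ?_) ?_
      · rw [hb, mul_left_comm]
        exact a.mul_mem_left _ ((hq t).1 ht)
      · intro h
        apply hcon.1
        rw [h, hb, ← mul_assoc]
        exact (hq _).1 hfg
end graded

theorem aux_finite_abs {S P : Type*} [CommRing S] [IsNoetherianRing S] [AddCommGroup P]
    [Module S P] (A A' : Submodule S P) (hA : A.FG) :
    {p : Ideal S | ∃ z ∈ A, p ∈ (A'.colon {z}).minimalPrimes}.Finite := by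
  have : Module.Finite S A := Module.Finite.iff_fg.2 hA
  let K : Submodule S A := A'.comap A.subtype
  refine (associatedPrimes.finite S (A ⧸ K)).subset ?_
  rintro p ⟨z, hz, hp⟩
  have e : (⊥ : Submodule S (A ⧸ K)).colon {K.mkQ ⟨z, hz⟩} = A'.colon {z} := by
    ext r
    rw [Submodule.mem_colon_singleton, Submodule.mem_bot, ← map_smul,
      Submodule.mkQ_apply, Submodule.Quotient.mk_eq_zero, Submodule.mem_colon_singleton]
    rfl
  rw [AssociatedPrimes.mem_iff, isAssociatedPrime_iff]
  exact ⟨hp.1.1, Submodule.exists_eq_colon_of_mem_minimalPrimes (e ▸ hp)⟩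

theorem aux_finite {R M : Type*} [CommRing R] [IsNoetherianRing R]
    [AddCommGroup M] [Module R M] [Module.Finite R M] (I : Ideal R) (N : Submodule R M) :
    {q : Ideal R | q.IsPrime ∧ ∃ n : ℕ, ∃ x ∈ I ^ n • N,
      ∀ r : R, r ∈ q ↔ r • x ∈ I ^ (n + 1) • N}.Finite := by
  let F : I.Filtration M := I.stableFiltration N
  let F' : I.Filtration M :=
    { N := fun n => I ^ (n + 1) • N
      mono := fun n => Submodule.smul_mono_left (Ideal.pow_le_pow_right (by omega))
      smul_le := fun n => by rw [← mul_smul, ← pow_succ'] }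
  have hFG : F.submodule.FG := by
    rw [Ideal.Filtration.submodule_fg_iff_stable]
    · exact I.stableFiltration_stable N
    · intro i; exact IsNoetherian.noetherian _
  have hfin := aux_finite_abs F.submodule F'.submodule hFG
  refine (hfin.image (Ideal.comap (algebraMap R (reesAlgebra I)))).subset ?_
  rintro q ⟨hqp, n, x, hx, hq⟩
  have hz : PolynomialModule.single R n x ∈ F.submodule := by
    rw [Ideal.Filtration.mem_submodule]
    intro i
    rw [PolynomialModule.coeff_single, Finsupp.single_apply]
    split_ifs with h
    · subst h; exact hx
    · exact zero_mem _
  have hcomap : (F'.submodule.colon {PolynomialModule.single R n x}).comap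
      (algebraMap R (reesAlgebra I)) = q := by
    ext r
    rw [Ideal.mem_comap, Submodule.mem_colon_singleton, hq]
    have e : algebraMap R (reesAlgebra I) r • PolynomialModule.single R n x
        = PolynomialModule.single R n (r • x) := by
      have := PolynomialModule.monomial_smul_single 0 r n x
      rw [zero_add] at this
      rw [← this]
      rfl
    rw [e, Ideal.Filtration.mem_submodule]
    constructor
    · intro h
      have := h n
      rwa [PolynomialModule.coeff_single, Finsupp.single_apply, if_pos rfl] at this
    · intro h i
      rw [PolynomialModule.coeff_single, Finsupp.single_apply]
      split_ifs with h'
      · subst h'; exact h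
      · exact zero_mem _
  obtain ⟨P, hP, hPq⟩ := Ideal.exists_minimalPrimes_comap_eq
    (I := F'.submodule.colon {PolynomialModule.single R n x})
    (algebraMap R (reesAlgebra I)) q (by
      rw [hcomap, Ideal.minimalPrimes_eq_subsingleton_self]; rfl)
  exact ⟨P, ⟨_, hz, hP⟩, hPq⟩

theorem aux_seq (e : ℕ → ℤ) (d C : ℤ) (n1 : ℕ) (h1 : ∀ n ≥ n1, e n + d ≤ e (n + 1))
    (h2 : ∀ n ≥ n1, e n ≤ d * n + C) : ∃ b : ℤ, ∃ n2, ∀ n ≥ n2, e n = d * n + b := by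
  obtain ⟨b, ⟨n2, hn2, hb⟩, hmax⟩ := Int.exists_greatest_of_bdd
    (P := fun z => ∃ n ≥ n1, e n - d * n = z)
    ⟨C, by rintro z ⟨n, hn, rfl⟩; linarith [h2 n hn]⟩ ⟨_, n1, le_rfl, rfl⟩
  refine ⟨b, n2, fun n hn => ?_⟩
  have h3 : b ≤ e n - d * n := by
    induction n, hn using Nat.le_induction with
    | base => exact hb.ge
    | succ n hn ih =>
      have := h1 n (hn2.le.trans hn)
      push_cast
      linarith
  have h4 := hmax _ ⟨n, le_trans hn2 hn, rfl⟩
  linarith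

/-- The submodule of elements of `I^n N` which are killed by `p` modulo `I^(n+1) N`. -/
def auxK {R M : Type*} [CommRing R] [AddCommGroup M] [Module R M] (I : Ideal R)
    (N : Submodule R M) (p : Ideal R) (n : ℕ) : Submodule R M where
  carrier := {x | x ∈ I ^ n • N ∧ ∀ r ∈ p, r • x ∈ I ^ (n + 1) • N}
  add_mem' := fun ha hb => ⟨add_mem ha.1 hb.1, fun r hr => by
    rw [smul_add]; exact add_mem (ha.2 r hr) (hb.2 r hr)⟩
  zero_mem' := ⟨zero_mem _, fun r _ => by rw [smul_zero]; exact zero_mem _⟩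
  smul_mem' := fun c x hx => ⟨Submodule.smul_mem _ c hx.1, fun r hr => by
    rw [smul_comm]; exact Submodule.smul_mem _ c (hx.2 r hr)⟩

theorem aux_stable {R M : Type*} [CommRing R] [IsNoetherianRing R]
    [AddCommGroup M] [Module R M] [Module.Finite R M] (I J : Ideal R) (N : Submodule R M)
    (m0 : ℕ) (hred : J * I ^ m0 = I ^ (m0 + 1)) (p : Ideal R) :
    ∃ n1 : ℕ, ∀ n ≥ n1, auxK I N p (n + 1) = J • auxK I N p n := by
  let F : I.Filtration M :=
    { N := auxK I N p
      mono := fun n x hx => by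
        have h : x ∈ I ^ (n + 1) • N := hx.1
        exact ⟨Submodule.smul_mono_left (Ideal.pow_le_pow_right (by omega)) h,
          fun r _ => Submodule.smul_mem _ r h⟩
      smul_le := fun n => by
        rw [Submodule.smul_le]
        intro a ha x hx
        refine ⟨?_, fun r hr => ?_⟩
        · rw [pow_succ', mul_smul]
          exact Submodule.smul_mem_smul ha hx.1
        · rw [smul_comm r a, pow_succ', mul_smul]
          exact Submodule.smul_mem_smul ha (hx.2 r hr) }
  have hle : F ≤ I.stableFiltration N := fun n x hx => hx.1
  obtain ⟨n1, h1⟩ := ((I.stableFiltration_stable N).of_le hle).exists_pow_smul_eq_of_ge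
  refine ⟨n1 + m0, fun n hn => ?_⟩
  have h2 : auxK I N p (n + 1) = I ^ (m0 + 1) • auxK I N p (n - m0) := by
    have e1 := h1 (n + 1) (by omega)
    have e2 := h1 (n - m0) (by omega)
    change auxK I N p (n + 1) = _ • auxK I N p n1 at e1
    change auxK I N p (n - m0) = _ • auxK I N p n1 at e2
    rw [e1, e2, ← mul_smul, ← pow_add]
    congr 2; omega
  have h3 : auxK I N p n = I ^ m0 • auxK I N p (n - m0) := by
    have e1 := h1 n (by omega)
    have e2 := h1 (n - m0) (by omega)
    change auxK I N p n = _ • auxK I N p n1 at e1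
    change auxK I N p (n - m0) = _ • auxK I N p n1 at e2
    rw [e1, e2, ← mul_smul, ← pow_add]
    congr 2; omega
  rw [h2, h3, ← hred, mul_smul]

theorem aux_ratliff {R M : Type*} [CommRing R] [IsNoetherianRing R]
    [AddCommGroup M] [Module R M] [Module.Finite R M] (I : Ideal R) (N : Submodule R M)
    (n0 : ℕ) (hpow : (I ^ n0 • ⊤ : Submodule R M) ≤ N) (y : R) (hyI : y ∈ I)
    (hy : ∀ x : M, y • x = 0 → x = 0) :
    ∃ n1 : ℕ, ∀ n ≥ n1, ∀ x : M, (∀ r ∈ I, r • x ∈ I ^ (n + 1) • N) → x ∈ I ^ n • N := by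
  obtain ⟨k, hk⟩ := Ideal.exists_pow_inf_eq_pow_smul I (LinearMap.range (LinearMap.lsmul R M y))
  have hQ : ∀ n, n + 1 ≥ k → ∀ x : M, (∀ r ∈ I, r • x ∈ I ^ (n + 1) • N) →
      x ∈ I ^ (n + 1 - k) • (⊤ : Submodule R M) := by
    intro n hn x hx
    have h1 : y • x ∈ I ^ (n + 1) • (⊤ : Submodule R M) ⊓ LinearMap.range (LinearMap.lsmul R M y) :=
      ⟨Submodule.smul_mono le_rfl le_top (hx y hyI), x, rfl⟩
    rw [hk _ hn] at h1
    have h2 : y • x ∈ I ^ (n + 1 - k) • LinearMap.range (LinearMap.lsmul R M y) :=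
      Submodule.smul_mono le_rfl inf_le_right h1
    rw [LinearMap.range_eq_map, ← Submodule.map_smul''] at h2
    obtain ⟨x', hx', he⟩ := h2
    have : x' = x := by
      rw [← sub_eq_zero]
      apply hy
      rw [smul_sub, sub_eq_zero]
      exact he
    rwa [← this]
  let Q : ℕ → Submodule R M := fun n =>
    { carrier := {x | ∀ r ∈ I, r • x ∈ I ^ (n + 1) • N}
      add_mem' := fun ha hb r hr => by
        rw [smul_add]; exact add_mem (ha r hr) (hb r hr)
      zero_mem' := fun r _ => by rw [smul_zero]; exact zero_mem _
      smul_mem' := fun c x hx r hr => by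
        rw [smul_comm]; exact Submodule.smul_mem _ c (hx r hr) }
  have hIQ : ∀ n, I • Q n ≤ I ^ (n + 1) • N := fun n => by
    rw [Submodule.smul_le]
    intro a ha x hx
    exact hx a ha
  let F : I.Filtration M :=
    { N := fun m => Q (m + k + n0)
      mono := fun m x hx r hr =>
        Submodule.smul_mono_left (Ideal.pow_le_pow_right (by omega)) (hx r hr)
      smul_le := fun m => by
        rw [Submodule.smul_le]
        intro a ha x hx r hr
        have h := Submodule.smul_mem_smul hr (hx a ha)
        rw [← mul_smul, ← pow_succ'] at h
        rwa [show m + 1 + k + n0 + 1 = m + k + n0 + 1 + 1 by omega] }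
  have hle : F ≤ I.stableFiltration N := fun m x hx => by
    have h1 := hQ (m + k + n0) (by omega) x hx
    rw [show m + k + n0 + 1 - k = (m + 1) + n0 by omega, pow_add, mul_smul] at h1
    exact Submodule.smul_mono_left (Ideal.pow_le_pow_right (Nat.le_succ m))
      (Submodule.smul_mono le_rfl hpow h1)
  obtain ⟨n2, h2⟩ := (I.stableFiltration_stable N).of_le hle
  refine ⟨n2 + 1 + k + n0, fun n hn x hx => ?_⟩
  have h3 : I • Q ((n - 1 - k - n0) + k + n0) = Q ((n - 1 - k - n0) + 1 + k + n0) :=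
    h2 (n - 1 - k - n0) (by omega)
  rw [show (n - 1 - k - n0) + k + n0 = n - 1 by omega,
    show (n - 1 - k - n0) + 1 + k + n0 = n by omega] at h3
  have h4 : x ∈ Q n := hx
  rw [← h3] at h4
  have h5 := hIQ _ h4
  rwa [show n - 1 + 1 = n by omega] at h5


/-- Same setup as Statement 9 (with `c > 0`).  Assume `(0 :_M I) = 0`,
that `Ass_R(M / I^n N)` is nonempty for all sufficiently large `n`, that `I^{n₀} M ⊆ N`
for some `n₀`, and moreover that `(0 :_M y 1) = 0` and `d 1 ≥ 1`.  Then the common leading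
coefficient of the eventually linear functions `indeg(I^n M / I^(n+1) N)`,
`v(I^n M / I^(n+1) N)` and `v(M / I^(n+1) N)` equals `d 1`; in particular there is `b ∈ ℤ`
with `v(M / I^(n+1) N) = d 1 * n + b` for all sufficiently large `n`. -/
theorem leading_coefficient_eq_d_one
    {R M : Type*} [CommRing R] [IsNoetherianRing R]
    [AddCommGroup M] [Module R M] [Module.Finite R M]
    (𝒜 : ℤ → AddSubgroup R) (ℳ : ℤ → AddSubgroup M)
    [GradedRing 𝒜] [DirectSum.Decomposition ℳ]
    (hsmul : ∀ (i j : ℤ), ∀ r ∈ 𝒜 i, ∀ x ∈ ℳ j, r • x ∈ ℳ (i + j))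
    (hA : ∀ i : ℤ, i < 0 → 𝒜 i = ⊥)
    (I : Ideal R) (hI : Ideal.IsHomogeneous 𝒜 I)
    (N : Submodule R M) (hN : ∀ x ∈ N, ∀ i : ℤ, (DirectSum.decompose ℳ x i : M) ∈ N)
    (c : ℕ) (y : Fin c → R) (d : Fin c → ℤ) (hdmono : Monotone d)
    (hy : ∀ j, y j ∈ 𝒜 (d j))
    (J : Ideal R) (hJgen : J = Ideal.span (Set.range y)) (hJI : J ≤ I)
    (m0 : ℕ) (hred : J * I ^ m0 = I ^ (m0 + 1))
    (h0 : ∀ x : M, (∀ r ∈ I, r • x = 0) → x = 0)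
    (hassne : ∃ n₀ : ℕ, ∀ n ≥ n₀, ∃ q : Ideal R, q.IsPrime ∧
      ∃ x : M, ∀ r : R, r ∈ q ↔ r • x ∈ (I ^ n • N : Submodule R M))
    (hpow : ∃ n₀ : ℕ, (I ^ n₀ • ⊤ : Submodule R M) ≤ N)
    (hc : 0 < c)
    (hy1 : ∀ x : M, y ⟨0, hc⟩ • x = 0 → x = 0)
    (hd1 : 1 ≤ d ⟨0, hc⟩) :
    ∃ b₁ b₂ b₃ : ℤ, ∃ n₁ : ℕ, ∀ n ≥ n₁,
      sInf {u : ℤ | ∃ x ∈ ℳ u, x ∈ (I ^ n • ⊤ : Submodule R M) ∧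
          x ∉ (I ^ (n + 1) • N : Submodule R M)} = d ⟨0, hc⟩ * (n : ℤ) + b₁ ∧
      sInf {u : ℤ | ∃ x ∈ ℳ u, x ∈ (I ^ n • ⊤ : Submodule R M) ∧
          ∃ q : Ideal R, q.IsPrime ∧
            ∀ r : R, r ∈ q ↔ r • x ∈ (I ^ (n + 1) • N : Submodule R M)}
        = d ⟨0, hc⟩ * (n : ℤ) + b₂ ∧
      sInf {u : ℤ | ∃ x ∈ ℳ u, ∃ q : Ideal R, q.IsPrime ∧
          ∀ r : R, r ∈ q ↔ r • x ∈ (I ^ (n + 1) • N : Submodule R M)}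
        = d ⟨0, hc⟩ * (n : ℤ) + b₃ := by
  classical
  obtain ⟨B, hB⟩ := aux_bdd 𝒜 ℳ hsmul hA
  obtain ⟨k0, hk0⟩ := hpow
  set y1 := y ⟨0, hc⟩ with hy1def
  set d1 := d ⟨0, hc⟩ with hd1def
  have hdle : ∀ j, d1 ≤ d j := fun j => hdmono (Nat.zero_le _)
  have hy1I : y1 ∈ I := hJI (hJgen ▸ Ideal.subset_span ⟨_, rfl⟩)
  have hy1A : y1 ∈ 𝒜 d1 := hy _
  have hhomN : ∀ n, ∀ x ∈ I ^ n • N, ∀ i : ℤ, (DirectSum.decompose ℳ x i : M) ∈ I ^ n • N :=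
    aux_pow_smul_hom 𝒜 ℳ hsmul I hI N hN
  have hhomM : ∀ n, ∀ x ∈ I ^ n • (⊤ : Submodule R M), ∀ i : ℤ,
      (DirectSum.decompose ℳ x i : M) ∈ I ^ n • (⊤ : Submodule R M) :=
    aux_pow_smul_hom 𝒜 ℳ hsmul I hI ⊤ (fun _ _ _ => trivial)
  have hNM : ∀ n, I ^ n • N ≤ I ^ n • (⊤ : Submodule R M) := fun n =>
    Submodule.smul_mono le_rfl le_top
  -- multiplication by powers of `y1`
  have hstep : ∀ n (x : M), x ∈ I ^ n • (⊤ : Submodule R M) →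
      y1 • x ∈ I ^ (n + 1) • (⊤ : Submodule R M) := by
    intro n x hx
    rw [pow_succ', mul_smul]
    exact Submodule.smul_mem_smul hy1I hx
  have hstepN : ∀ n (x : M), x ∈ I ^ n • N → y1 • x ∈ I ^ (n + 1) • N := by
    intro n x hx
    rw [pow_succ', mul_smul]
    exact Submodule.smul_mem_smul hy1I hx
  -- initial degrees of `I^n M`
  let S : ℕ → Set ℤ := fun n =>
    {u | ∃ x ∈ ℳ u, x ∈ (I ^ n • ⊤ : Submodule R M) ∧ x ≠ 0}
  have hSb : ∀ n, BddBelow (S n) := fun n => ⟨B, by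
    rintro u ⟨x, hx, -, h⟩; exact hB u x hx h⟩
  have hSup : ∀ n, ∀ u ∈ S n, u + d1 ∈ S (n + 1) := by
    rintro n u ⟨x, hx, hxI, hx0⟩
    refine ⟨y1 • x, ?_, hstep n x hxI, fun h => hx0 (hy1 x h)⟩
    rw [add_comm]
    exact hsmul _ _ _ hy1A _ hx
  have hSne : ∀ n, (S n).Nonempty := by
    intro n
    induction n with
    | zero =>
      obtain ⟨n₀, h⟩ := hassne
      obtain ⟨q, hqp, x, hq⟩ := h n₀ le_rfl
      have hx0 : x ≠ 0 := by
        rintro rfl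
        apply hqp.ne_top
        rw [Ideal.eq_top_iff_one, hq, smul_zero]
        exact zero_mem _
      have : ∃ i, (DirectSum.decompose ℳ x i : M) ≠ 0 := by
        by_contra! hcon
        apply hx0
        rw [← DirectSum.sum_support_decompose ℳ x]
        exact Finset.sum_eq_zero fun i _ => hcon i
      obtain ⟨i, hi⟩ := this
      exact ⟨i, _, (DirectSum.decompose ℳ x i).2, by simp, hi⟩
    | succ n ih =>
      obtain ⟨u, hu⟩ := ih
      exact ⟨_, hSup n u hu⟩
  have hSdown : ∀ n ≥ m0, ∀ u ∈ S (n + 1), ∃ u' ∈ S n, u' ≤ u - d1 := by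
    rintro n hn u ⟨x, hx, hxI, hx0⟩
    have e : I ^ (n + 1) = J * I ^ n := by
      rw [show n + 1 = (m0 + 1) + (n - m0) by omega, pow_add, ← hred, mul_assoc, ← pow_add]
      congr 2; omega
    rw [e, mul_smul, hJgen] at hxI
    obtain ⟨w, hwK, hwd, hw⟩ := aux_split 𝒜 ℳ hsmul y d hy _ (hhomM n) hx hxI
    have : ∃ j, w j ≠ 0 := by
      by_contra! hcon
      apply hx0
      rw [hw]
      exact Finset.sum_eq_zero fun j _ => by rw [hcon j, smul_zero]
    obtain ⟨j, hj⟩ := this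
    exact ⟨u - d j, ⟨w j, hwd j, hwK j, hj⟩, by linarith [hdle j]⟩
  let g : ℕ → ℤ := fun n => sInf (S n)
  have hgmem : ∀ n, g n ∈ S n := fun n => Int.csInf_mem (hSne n) (hSb n)
  have hgle : ∀ n, ∀ u ∈ S n, g n ≤ u := fun n u hu => csInf_le (hSb n) hu
  have hgup : ∀ n, g (n + 1) ≤ g n + d1 := fun n => hgle _ _ (hSup n _ (hgmem n))
  have hgdown : ∀ n ≥ m0, g n + d1 ≤ g (n + 1) := by
    intro n hn
    obtain ⟨u', hu', hle⟩ := hSdown n hn _ (hgmem (n + 1))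
    linarith [hgle n u' hu']
  obtain ⟨b₁, hb₁⟩ : ∃ b₁ : ℤ, ∀ n ≥ m0, g n = d1 * n + b₁ := by
    refine ⟨g m0 - d1 * m0, fun n hn => ?_⟩
    induction n, hn using Nat.le_induction with
    | base => ring
    | succ n hn ih =>
      have h1 := hgup n
      have h2 := hgdown n hn
      push_cast
      linarith
  -- elements of minimal degree are not in `I^(n+1) N`
  have hgnot : ∀ n ≥ m0, ∀ x ∈ ℳ (g n), x ≠ 0 → x ∉ I ^ (n + 1) • N := by
    intro n hn x hx hx0 hmem
    have h1 : g n ∈ S (n + 1) := ⟨x, hx, hNM _ hmem, hx0⟩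
    have h2 := hgle _ _ h1
    have h3 := hgdown n hn
    linarith
  have hf1 : ∀ n ≥ m0, sInf {u : ℤ | ∃ x ∈ ℳ u, x ∈ (I ^ n • ⊤ : Submodule R M) ∧
          x ∉ (I ^ (n + 1) • N : Submodule R M)} = d1 * (n : ℤ) + b₁ := by
    intro n hn
    rw [← hb₁ n hn]
    refine IsLeast.csInf_eq ⟨?_, ?_⟩
    · obtain ⟨x, hx, hxI, hx0⟩ := hgmem n
      exact ⟨x, hx, hxI, hgnot n hn x hx hx0⟩
    · rintro u ⟨x, hx, hxI, hxn⟩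
      refine hgle n u ⟨x, hx, hxI, ?_⟩
      rintro rfl
      exact hxn (zero_mem _)
  -- the third set
  let E : ℕ → Set ℤ := fun n => {u : ℤ | ∃ x ∈ ℳ u, ∃ q : Ideal R, q.IsPrime ∧
          ∀ r : R, r ∈ q ↔ r • x ∈ (I ^ (n + 1) • N : Submodule R M)}
  have hEb : ∀ n, BddBelow (E n) := fun n => ⟨B, by
    rintro u ⟨x, hx, q, hqp, hq⟩
    refine hB u x hx ?_
    rintro rfl
    apply hqp.ne_top
    rw [Ideal.eq_top_iff_one, hq, smul_zero]
    exact zero_mem _⟩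
  obtain ⟨nR, hR⟩ := aux_ratliff I N k0 hk0 y1 hy1I hy1
  have hmemN : ∀ n ≥ nR, ∀ x : M, ∀ q : Ideal R, q.IsPrime →
      (∀ r : R, r ∈ q ↔ r • x ∈ (I ^ (n + 1) • N : Submodule R M)) → x ∈ I ^ n • N := by
    intro n hn x q hqp hq
    refine hR n hn x fun r hr => (hq r).1 ?_
    refine hqp.mem_of_pow_mem (n + 1 + k0) ((hq _).2 ?_)
    have h1 : r ^ (n + 1 + k0) • x ∈ I ^ (n + 1 + k0) • (⊤ : Submodule R M) :=
      Submodule.smul_mem_smul (Ideal.pow_mem_pow hr _) trivial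
    rw [pow_add I, mul_smul] at h1
    exact Submodule.smul_mono le_rfl hk0 h1
  have hf23 : ∀ n ≥ nR, {u : ℤ | ∃ x ∈ ℳ u, x ∈ (I ^ n • ⊤ : Submodule R M) ∧
          ∃ q : Ideal R, q.IsPrime ∧
            ∀ r : R, r ∈ q ↔ r • x ∈ (I ^ (n + 1) • N : Submodule R M)} = E n := by
    intro n hn
    ext u
    constructor
    · rintro ⟨x, hx, -, q, hqp, hq⟩
      exact ⟨x, hx, q, hqp, hq⟩
    · rintro ⟨x, hx, q, hqp, hq⟩
      exact ⟨x, hx, hNM n (hmemN n hn x q hqp hq), q, hqp, hq⟩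
  -- upper bound
  obtain ⟨C, n2, hup⟩ : ∃ C : ℤ, ∃ n2 : ℕ, ∀ n ≥ n2, d1 * (n : ℤ) + C ∈ E n := by
    obtain ⟨z, hz, hzI, hz0⟩ := hgmem m0
    have hzk : ∀ k : ℕ, y1 ^ k • z ∈ ℳ (g (m0 + k)) ∧ y1 ^ k • z ≠ 0 := by
      intro k
      induction k with
      | zero => simpa using ⟨hz, hz0⟩
      | succ k ih =>
        rw [pow_succ', mul_smul]
        refine ⟨?_, fun h => ih.2 (hy1 _ h)⟩
        have h1 := hsmul _ _ _ hy1A _ ih.1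
        have h2 := hgup (m0 + k)
        have h3 := hgdown (m0 + k) (by omega)
        rwa [show d1 + g (m0 + k) = g (m0 + (k + 1)) by
          rw [← add_assoc]; linarith] at h1
    let a : ℕ →o Ideal R :=
      { toFun := fun k => (I ^ (m0 + k + 1) • N).colon {y1 ^ k • z}
        monotone' := monotone_nat_of_le_succ fun k r hr => by
          rw [Submodule.mem_colon_singleton] at hr ⊢
          have h1 := hstepN _ _ hr
          rwa [smul_comm, ← mul_smul y1, ← pow_succ'] at h1 }
    have ha : ∀ k r, r ∈ a k ↔ r • y1 ^ k • z ∈ I ^ (m0 + k + 1) • N := fun k r =>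
      Submodule.mem_colon_singleton
    obtain ⟨k1, hk1⟩ := monotone_stabilizes_iff_noetherian.2 ‹IsNoetherianRing R› a
    have hhom : (a k1).IsHomogeneous 𝒜 :=
      aux_colon_hom 𝒜 ℳ hsmul _ (hhomN _) (hzk k1).1 (a k1) (ha k1)
    have hne : a k1 ≠ ⊤ := by
      intro h
      rw [Ideal.eq_top_iff_one, ha, one_smul] at h
      exact hgnot (m0 + k1) (by omega) _ (hzk k1).1 (hzk k1).2 h
    obtain ⟨s, r, hr, q, hqp, hq⟩ := aux_prime 𝒜 (a k1) hhom hne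
    refine ⟨b₁ + s, m0 + k1, fun n hn => ?_⟩
    obtain ⟨k, rfl⟩ : ∃ k, n = m0 + k := ⟨n - m0, by omega⟩
    refine ⟨r • y1 ^ k • z, ?_, q, hqp, fun t => ?_⟩
    · have h1 := hsmul _ _ _ hr _ (hzk k).1
      rw [hb₁ _ (by omega)] at h1
      rwa [show s + (d1 * ((m0 + k : ℕ) : ℤ) + b₁) = d1 * ((m0 + k : ℕ) : ℤ) + (b₁ + s) by ring]
        at h1
    · rw [hq, hk1 k (by omega), ha, mul_smul]
  -- descent
  have hfin := aux_finite I N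
  choose f hf using aux_stable I J N m0 hred
  obtain ⟨n3, hn3⟩ := (hfin.image f).bddAbove
  have hEdown : ∀ n ≥ max nR n3, ∀ u ∈ E (n + 1), ∃ u' ∈ E n, u' ≤ u - d1 := by
    rintro n hn u ⟨x, hx, q, hqp, hq⟩
    have hnR : nR ≤ n := le_trans (le_max_left _ _) hn
    have hxN : x ∈ I ^ (n + 1) • N := hmemN (n + 1) (by omega) x q hqp hq
    have hfq : f q ≤ n := (hn3 ⟨q, ⟨hqp, n + 1, x, hxN, hq⟩, rfl⟩).trans
      (le_trans (le_max_right _ _) hn)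
    have hxK : x ∈ auxK I N q (n + 1) := ⟨hxN, fun r hr => (hq r).1 hr⟩
    rw [hf q n hfq, hJgen] at hxK
    have hqh : q.IsHomogeneous 𝒜 := aux_colon_hom 𝒜 ℳ hsmul _ (hhomN _) hx q hq
    have hKh : ∀ x ∈ auxK I N q n, ∀ i : ℤ,
        (DirectSum.decompose ℳ x i : M) ∈ auxK I N q n := by
      intro x hx i
      refine ⟨hhomN n x hx.1 i, fun r hr => ?_⟩
      rw [← DirectSum.sum_support_decompose 𝒜 r, Finset.sum_smul]
      refine Submodule.sum_mem _ fun k _ => ?_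
      have h1 := hhomN (n + 1) _ (hx.2 _ (hqh k hr)) (i + k)
      rwa [aux_comp_smul 𝒜 ℳ hsmul (DirectSum.decompose 𝒜 r k).2, add_sub_cancel_right] at h1
    obtain ⟨w, hwK, hwd, hw⟩ := aux_split 𝒜 ℳ hsmul y d hy _ hKh hx hxK
    have hyI : ∀ j, y j ∈ I := fun j => hJI (hJgen ▸ Ideal.subset_span ⟨_, rfl⟩)
    -- some `w j` has annihilator contained in `q`
    have hex : ∃ j, ∀ r, r • w j ∈ I ^ (n + 1) • N → r ∈ q := by
      by_contra! hcon
      choose r hr hrq using hcon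
      have h1 : (∏ j, r j) ∈ q := by
        rw [hq, hw, Finset.smul_sum]
        refine Submodule.sum_mem _ fun j _ => ?_
        rw [smul_comm, pow_succ', mul_smul]
        refine Submodule.smul_mem_smul (hyI j) ?_
        rw [← Finset.mul_prod_erase _ _ (Finset.mem_univ j), mul_comm, mul_smul]
        exact Submodule.smul_mem _ _ (hr j)
      rw [hqp.prod_mem_iff] at h1
      obtain ⟨j, -, hj⟩ := h1
      exact hrq j hj
    obtain ⟨j, hj⟩ := hex
    exact ⟨u - d j, ⟨w j, hwd j, q, hqp, fun r => ⟨fun h => (hwK j).2 r h, hj r⟩⟩,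
      by linarith [hdle j]⟩
  obtain ⟨b₃, n4, hb₃⟩ := aux_seq (fun n => sInf (E n)) d1 C (max (max nR n3) n2)
    (fun n hn => by
      have hne : (E (n + 1)).Nonempty := ⟨_, hup (n + 1) (by
        have := le_trans (le_max_right _ _) hn; omega)⟩
      obtain ⟨u', hu', hle⟩ := hEdown n (le_trans (le_max_left _ _) hn) _
        (Int.csInf_mem hne (hEb (n + 1)))
      have := csInf_le (hEb n) hu'
      linarith)
    (fun n hn => csInf_le (hEb n) (hup n (le_trans (le_max_right _ _) hn)))
  refine ⟨b₁, b₃, b₃, max (max m0 nR) n4, fun n hn => ⟨hf1 n ?_, ?_, hb₃ n ?_⟩⟩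
  · exact le_trans (le_trans (le_max_left _ _) (le_max_left _ _)) hn
  · rw [hf23 n (le_trans (le_trans (le_max_right _ _) (le_max_left _ _)) hn)]
    exact hb₃ n (le_trans (le_max_right _ _) hn)
  · exact le_trans (le_max_right _ _) hn
end

section
/- Let k be a field, let R = k[X,Y] be the standard graded polynomial ring, let a, b be positive integers, let M = R/(XY^b) and I = (X^a). Then (0 :_M I) ≠ 0, and for every n ≥ 1: Ass_R(I^n M) = {(Y)}, indeg(I^n M) = a·n, and v(I^n M) = v_{(Y)}(I^n M) = a·n + b − 1. -/
open MvPolynomial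

set_option synthInstance.maxHeartbeats 1000000
set_option maxHeartbeats 1000000

namespace VNum

variable {k : Type*} [Field k]

lemma prime_X (i : Fin 2) : Prime (X i : MvPolynomial (Fin 2) k) := MvPolynomial.X_prime

lemma not_dvd : ¬ (X 1 : MvPolynomial (Fin 2) k) ∣ X 0 := by
  rw [X_dvd_X]; simp

lemma not_dvd' : ¬ (X 0 : MvPolynomial (Fin 2) k) ∣ X 1 := by
  rw [X_dvd_X]; simp

lemma key (b c : ℕ) (hc : 1 ≤ c) (w : MvPolynomial (Fin 2) k) :
    (X 0 * X 1 ^ b ∣ X 0 ^ c * w) ↔ X 1 ^ b ∣ w := by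
  constructor
  · intro h
    have h1 : (X 1 : MvPolynomial (Fin 2) k) ^ b ∣ X 0 ^ c * w := (Dvd.intro_left _ rfl).trans h
    exact (prime_X 1).pow_dvd_of_dvd_mul_left b
      (fun h2 => not_dvd ((prime_X 1).dvd_of_dvd_pow h2)) h1
  · intro h
    exact mul_dvd_mul (dvd_pow_self _ (by omega)) h

lemma deg_bound (b c m u : ℕ) (f g h : MvPolynomial (Fin 2) k) (hf : f.IsHomogeneous u)
    (hfg : X 0 * X 1 ^ b * h = f - X 0 ^ c * X 1 ^ m * g)
    (hn : ¬ (X 0 * X 1 ^ b ∣ f)) : c + m ≤ u := by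
  have hm : ∀ i j : ℕ, (X 0 ^ i * X 1 ^ j : MvPolynomial (Fin 2) k)
      = monomial (Finsupp.single 0 i + Finsupp.single 1 j) 1 := by
    intro i j
    simp [X_pow_eq_monomial, monomial_mul]
  have hd : ∀ (i j : ℕ) (p : MvPolynomial (Fin 2) k), (X 0 ^ i * X 1 ^ j ∣ p) ↔
      ∀ d ∈ p.support, Finsupp.single 0 i + Finsupp.single 1 j ≤ d := by
    intro i j p
    have := mem_ideal_span_monomial_image (x := p) (s := {Finsupp.single 0 i + Finsupp.single 1 j})
    rw [Set.image_singleton, Ideal.mem_span_singleton, ← hm] at this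
    simpa using this
  have hd1 := hd 1 b
  rw [pow_one] at hd1
  rw [hd1] at hn
  push Not at hn
  obtain ⟨d, hdf, hdn⟩ := hn
  have h1 : coeff d (X 0 * X 1 ^ b * h) = 0 := by
    by_contra hne
    exact hdn ((hd1 _).1 (dvd_mul_right _ _) d (mem_support_iff.2 hne))
  rw [hfg, coeff_sub, sub_eq_zero] at h1
  have h2 : coeff d f ≠ 0 := mem_support_iff.1 hdf
  have h3 := (hd c m _).1 (dvd_mul_right _ g) d (mem_support_iff.2 (h1 ▸ h2))
  have h4 := hf h2
  have h5 := h3 0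
  have h6 := h3 1
  simp [Finsupp.weight_apply, Finsupp.sum_fintype] at h4 h5 h6
  omega

end VNum

/-- Let `k` be a field, `R = k[X,Y]` standard graded, `a, b ≥ 1`,
`M = R/(X·Y^b)` and `I = (X^a)`.  Then `(0 :_M I) ≠ 0`, and for every `n ≥ 1`:
`Ass_R(I^n M) = {(Y)}` (associated primes being the primes of the form `(0 :_R z)` with
`z ∈ I^n M`), `indeg(I^n M) = a * n` (the least degree of a nonzero homogeneous element of
`I^n M`, homogeneous elements of `M` of degree `u` being the images of homogeneous
polynomials of degree `u`), and
`v(I^n M) = v_{(Y)}(I^n M) = a * n + b - 1`, where `v_{(Y)}` takes the infimum of degrees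
of homogeneous elements of `I^n M` with annihilator exactly `(Y)`, and `v` over those with
prime annihilator. -/
theorem v_number_of_powers_of_principal_ideal_in_R_mod_XYb
    (k : Type*) [Field k] (a b : ℕ) (ha : 1 ≤ a) (hb : 1 ≤ b)
    (Q : Ideal (MvPolynomial (Fin 2) k))
    (hQ : Q = Ideal.span {(X 0 : MvPolynomial (Fin 2) k) * X 1 ^ b})
    (I : Ideal (MvPolynomial (Fin 2) k))
    (hI : I = Ideal.span {(X 0 : MvPolynomial (Fin 2) k) ^ a})
    (pY : Ideal (MvPolynomial (Fin 2) k))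
    (hpY : pY = Ideal.span {(X 1 : MvPolynomial (Fin 2) k)}) :
    (∃ z : MvPolynomial (Fin 2) k ⧸ Q, z ≠ 0 ∧ ∀ r ∈ I, r • z = 0) ∧
    ∀ n : ℕ, 1 ≤ n →
      {q : Ideal (MvPolynomial (Fin 2) k) | q.IsPrime ∧
          ∃ z ∈ (I ^ n • ⊤ : Submodule (MvPolynomial (Fin 2) k) (MvPolynomial (Fin 2) k ⧸ Q)),
            ∀ r : MvPolynomial (Fin 2) k, r ∈ q ↔ r • z = 0} = {pY} ∧
      sInf {u : ℕ | ∃ f : MvPolynomial (Fin 2) k, f.IsHomogeneous u ∧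
          Ideal.Quotient.mk Q f ∈
            (I ^ n • ⊤ : Submodule (MvPolynomial (Fin 2) k) (MvPolynomial (Fin 2) k ⧸ Q)) ∧
          Ideal.Quotient.mk Q f ≠ 0} = a * n ∧
      sInf {u : ℕ | ∃ f : MvPolynomial (Fin 2) k, f.IsHomogeneous u ∧
          Ideal.Quotient.mk Q f ∈
            (I ^ n • ⊤ : Submodule (MvPolynomial (Fin 2) k) (MvPolynomial (Fin 2) k ⧸ Q)) ∧
          ∀ r : MvPolynomial (Fin 2) k, r ∈ pY ↔ r • Ideal.Quotient.mk Q f = 0}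
        = a * n + b - 1 ∧
      sInf {u : ℕ | ∃ f : MvPolynomial (Fin 2) k, f.IsHomogeneous u ∧
          Ideal.Quotient.mk Q f ∈
            (I ^ n • ⊤ : Submodule (MvPolynomial (Fin 2) k) (MvPolynomial (Fin 2) k ⧸ Q)) ∧
          ∃ q : Ideal (MvPolynomial (Fin 2) k), q.IsPrime ∧
            ∀ r : MvPolynomial (Fin 2) k, r ∈ q ↔ r • Ideal.Quotient.mk Q f = 0}
        = a * n + b - 1 := by
  subst hQ hI hpY
  have h0 : ∀ f : MvPolynomial (Fin 2) k,
      Ideal.Quotient.mk (Ideal.span {(X 0 : MvPolynomial (Fin 2) k) * X 1 ^ b}) f = 0 ↔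
        X 0 * X 1 ^ b ∣ f := fun f => by
    rw [Ideal.Quotient.eq_zero_iff_mem, Ideal.mem_span_singleton]
  have hsm : ∀ r f : MvPolynomial (Fin 2) k,
      r • Ideal.Quotient.mk (Ideal.span {(X 0 : MvPolynomial (Fin 2) k) * X 1 ^ b}) f =
      Ideal.Quotient.mk (Ideal.span {(X 0 : MvPolynomial (Fin 2) k) * X 1 ^ b}) (r * f) :=
    fun r f => rfl
  refine ⟨⟨Ideal.Quotient.mk _ (X 1 ^ b), ?_, ?_⟩, ?_⟩
  · rw [Ne, h0]
    intro h
    exact VNum.not_dvd' ((VNum.prime_X 0).dvd_of_dvd_pow ((dvd_mul_right _ _).trans h))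
  · intro r hr
    rw [Ideal.mem_span_singleton] at hr
    rw [hsm, h0]
    exact mul_dvd_mul ((dvd_pow_self _ (by omega)).trans hr) dvd_rfl
  intro n hn
  have hc : 1 ≤ a * n := Nat.mul_pos ha hn
  rw [Ideal.span_singleton_pow, ← pow_mul]
  generalize a * n = c at hc
  have hmem : ∀ z : MvPolynomial (Fin 2) k ⧸ Ideal.span {(X 0 : MvPolynomial (Fin 2) k) * X 1 ^ b},
      z ∈ (Ideal.span {(X 0 : MvPolynomial (Fin 2) k) ^ c} • ⊤ : Submodule (MvPolynomial (Fin 2) k)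
        (MvPolynomial (Fin 2) k ⧸ Ideal.span {(X 0 : MvPolynomial (Fin 2) k) * X 1 ^ b})) ↔
      ∃ g, z = Ideal.Quotient.mk _ (X 0 ^ c * g) := by
    intro z
    rw [Submodule.ideal_span_singleton_smul, Submodule.mem_smul_pointwise_iff_exists]
    constructor
    · rintro ⟨y, -, rfl⟩
      obtain ⟨g, rfl⟩ := Ideal.Quotient.mk_surjective y
      exact ⟨g, rfl⟩
    · rintro ⟨g, rfl⟩
      exact ⟨Ideal.Quotient.mk _ g, trivial, rfl⟩
  have hann : ∀ r g : MvPolynomial (Fin 2) k,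
      r • Ideal.Quotient.mk (Ideal.span {(X 0 : MvPolynomial (Fin 2) k) * X 1 ^ b}) (X 0 ^ c * g) = 0
        ↔ X 1 ^ b ∣ r * g := by
    intro r g
    rw [hsm, h0, mul_left_comm, VNum.key b c hc]
  have hprime : (Ideal.span {(X 1 : MvPolynomial (Fin 2) k)}).IsPrime :=
    (Ideal.span_singleton_prime (VNum.prime_X 1).ne_zero).2 (VNum.prime_X 1)
  have huniq : ∀ q : Ideal (MvPolynomial (Fin 2) k), q.IsPrime → ∀ g : MvPolynomial (Fin 2) k,
      (∀ r, r ∈ q ↔ X 1 ^ b ∣ r * g) → q = Ideal.span {X 1} := by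
    intro q hq g hg
    ext r
    rw [Ideal.mem_span_singleton]
    constructor
    · intro hr
      by_contra hnd
      have h1 := (VNum.prime_X 1).pow_dvd_of_dvd_mul_left b hnd ((hg r).1 hr)
      exact hq.ne_top ((Ideal.eq_top_iff_one q).2 ((hg 1).2 (by rwa [one_mul])))
    · intro hr
      exact Ideal.mem_of_dvd _ hr (hq.mem_of_pow_mem b ((hg _).2 (dvd_mul_right _ _)))
  have hwit : ∀ r : MvPolynomial (Fin 2) k, r ∈ Ideal.span {(X 1 : MvPolynomial (Fin 2) k)} ↔
      r • Ideal.Quotient.mk (Ideal.span {(X 0 : MvPolynomial (Fin 2) k) * X 1 ^ b})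
        (X 0 ^ c * X 1 ^ (b - 1)) = 0 := by
    intro r
    rw [hann, Ideal.mem_span_singleton]
    obtain ⟨b, rfl⟩ : ∃ b', b = b' + 1 := ⟨b - 1, by omega⟩
    rw [Nat.add_sub_cancel, pow_succ', mul_dvd_mul_iff_right (pow_ne_zero _ (VNum.prime_X 1).ne_zero)]
  have hwithom : (X 0 ^ c * X 1 ^ (b - 1) : MvPolynomial (Fin 2) k).IsHomogeneous (c + b - 1) := by
    rw [Nat.add_sub_assoc hb]
    exact (isHomogeneous_X_pow 0 c).mul (isHomogeneous_X_pow 1 (b - 1))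
  have hlow : ∀ u, ∀ f : MvPolynomial (Fin 2) k, f.IsHomogeneous u → ∀ g : MvPolynomial (Fin 2) k,
      Ideal.Quotient.mk (Ideal.span {(X 0 : MvPolynomial (Fin 2) k) * X 1 ^ b}) f =
        Ideal.Quotient.mk _ (X 0 ^ c * g) →
      (∀ r, r ∈ Ideal.span {(X 1 : MvPolynomial (Fin 2) k)} ↔ X 1 ^ b ∣ r * g) →
      c + b - 1 ≤ u := by
    intro u f hf g hfg hg
    have h1 : (X 1 : MvPolynomial (Fin 2) k) ^ b ∣ X 1 * g :=
      (hg _).1 (Ideal.mem_span_singleton_self _)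
    have h2 : (X 1 : MvPolynomial (Fin 2) k) ^ (b - 1) ∣ g := by
      obtain ⟨b, rfl⟩ : ∃ b', b = b' + 1 := ⟨b - 1, by omega⟩
      rwa [pow_succ', mul_dvd_mul_iff_left (VNum.prime_X 1).ne_zero] at h1
    have h3 : ¬ X 0 * X 1 ^ b ∣ f := by
      rw [← h0, hfg, h0, VNum.key b c hc]
      intro h
      exact hprime.ne_top ((Ideal.eq_top_iff_one _).2 ((hg 1).2 (by rwa [one_mul])))
    obtain ⟨g', rfl⟩ := h2
    rw [Ideal.Quotient.eq, Ideal.mem_span_singleton] at hfg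
    obtain ⟨h, hh⟩ := hfg
    have := VNum.deg_bound b c (b - 1) u f g' h hf (by rw [← hh]; ring) h3
    omega
  refine ⟨?_, ?_, ?_, ?_⟩
  · ext q
    simp only [Set.mem_setOf_eq, Set.mem_singleton_iff]
    constructor
    · rintro ⟨hq, z, hz, hr⟩
      obtain ⟨g, rfl⟩ := (hmem z).1 hz
      exact huniq q hq g (fun r => by rw [hr, hann])
    · rintro rfl
      exact ⟨hprime, _, (hmem _).2 ⟨_, rfl⟩, hwit⟩
  · refine IsLeast.csInf_eq ⟨⟨X 0 ^ c, isHomogeneous_X_pow 0 c, (hmem _).2 ⟨1, by rw [mul_one]⟩, ?_⟩, ?_⟩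
    · rw [Ne, h0, ← mul_one (X 0 ^ c), VNum.key b c hc]
      intro h
      exact (VNum.prime_X (k := k) 1).not_unit
        (isUnit_of_dvd_one ((dvd_pow_self _ (by omega)).trans h))
    · rintro u ⟨f, hf, hfm, hfn⟩
      obtain ⟨g, hg⟩ := (hmem _).1 hfm
      rw [Ne, h0] at hfn
      rw [Ideal.Quotient.eq, Ideal.mem_span_singleton] at hg
      obtain ⟨h, hh⟩ := hg
      have := VNum.deg_bound b c 0 u f g h hf (by rw [← hh]; ring) hfn
      omega
  · refine IsLeast.csInf_eq ⟨⟨_, hwithom, (hmem _).2 ⟨_, rfl⟩, hwit⟩, ?_⟩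
    rintro u ⟨f, hf, hfm, hr⟩
    obtain ⟨g, hg⟩ := (hmem _).1 hfm
    exact hlow u f hf g hg (fun r => by rw [hr, hg, hann])
  · refine IsLeast.csInf_eq ⟨⟨_, hwithom, (hmem _).2 ⟨_, rfl⟩, _, hprime, hwit⟩, ?_⟩
    rintro u ⟨f, hf, hfm, q, hq, hr⟩
    obtain ⟨g, hg⟩ := (hmem _).1 hfm
    have hr' : ∀ r, r ∈ q ↔ X 1 ^ b ∣ r * g := fun r => by rw [hr, hg, hann]
    have := huniq q hq g hr'
    subst this
    exact hlow u f hf g hg hr'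
end
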